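/- arXiv:1807.00535 — 5 statements merged into one kernel-verified Lean document; each statement's English description precedes it below -/
import Mathlib

section
/- Let F be a field of characteristic different from 2, let A be a central simple F-algebra and let σ be an involution of the first kind on A. Let a ∈ F^× be a nonsquare, K = F(u) with u² = a the corresponding quadratic field extension, ι the nontrivial F-automorphism of K, and (B,τ) = (A ⊗_F K, σ ⊗ ι). If there exists s ∈ A with σ(s) = s and s² = a·1, then (B,τ) is hyperbolic; in fact e = (1/2)(1⊗1 + s⊗u⁻¹) ∈ B satisfies e² = e and τ(e) = 1 − e. -/
open scoped TensorProduct

/-- Let `F` be a field of characteristic different from 2, `A` a central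
simple `F`-algebra with an involution `σ` of the first kind, `a ∈ F^×` a nonsquare,
`K = F(u)` with `u² = a`, `ι` the nontrivial `F`-automorphism of `K` (so `ι u = -u`),
and `(B, τ) = (A ⊗_F K, σ ⊗ ι)`.  If `s ∈ A` satisfies `σ s = s` and `s² = a·1`, then
`e = ½(1⊗1 + s⊗u⁻¹)` is an idempotent with `τ e = 1 - e`; in particular `(B, τ)` is
hyperbolic. -/
theorem unitary_extension_hyperbolic_of_symmetric_square_root
    (F A K : Type*) [Field F] [Ring A] [Algebra F A]
    (h2 : (2 : F) ≠ 0)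
    [Algebra.IsCentral F A] [IsSimpleRing A] [FiniteDimensional F A]
    (σ : A →ₗ[F] A) (hσmul : ∀ x y : A, σ (x * y) = σ y * σ x)
    (hσinv : ∀ x : A, σ (σ x) = x)
    [Field K] [Algebra F K]
    (a : F) (ha : a ≠ 0) (hns : ¬ ∃ b : F, b * b = a)
    (u : K) (hu : u * u = algebraMap F K a) (hgen : Algebra.adjoin F {u} = ⊤)
    (ι : K ≃ₐ[F] K) (hι : ι u = -u)
    (s : A) (hs : σ s = s) (hs2 : s * s = algebraMap F A a) :
    (∀ e : A ⊗[F] K, e = (2 : F)⁻¹ • ((1 : A) ⊗ₜ[F] (1 : K) + s ⊗ₜ[F] u⁻¹) →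
      e * e = e ∧ TensorProduct.map σ ι.toLinearMap e = 1 - e) ∧
    ∃ e : A ⊗[F] K, e * e = e ∧ TensorProduct.map σ ι.toLinearMap e = 1 - e := by
  have hσ1 : σ 1 = 1 := by
    have h := hσmul (σ 1) 1
    rw [mul_one, hσinv, mul_one] at h
    exact h.symm
  have haK : algebraMap F K a ≠ 0 := by
    simpa using ha
  have hx : (s ⊗ₜ[F] u⁻¹ : A ⊗[F] K) * (s ⊗ₜ[F] u⁻¹) = 1 := by
    rw [Algebra.TensorProduct.tmul_mul_tmul, hs2, ← mul_inv, hu, Algebra.algebraMap_eq_smul_one,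
      TensorProduct.smul_tmul, Algebra.smul_def, mul_inv_cancel₀ haK,
      Algebra.TensorProduct.one_def]
  have key : ∀ e : A ⊗[F] K, e = (2 : F)⁻¹ • ((1 : A) ⊗ₜ[F] (1 : K) + s ⊗ₜ[F] u⁻¹) →
      e * e = e ∧ TensorProduct.map σ ι.toLinearMap e = 1 - e := by
    rintro e rfl
    constructor
    · rw [← Algebra.TensorProduct.one_def, smul_mul_smul_comm, add_mul, mul_add, mul_add, hx,
        one_mul, one_mul, mul_one]
      generalize (s ⊗ₜ[F] u⁻¹ : A ⊗[F] K) = x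
      match_scalars <;> field_simp <;> norm_num
    · rw [map_smul, map_add, TensorProduct.map_tmul, TensorProduct.map_tmul, hσ1, hs]
      simp only [AlgEquiv.toLinearMap_apply, map_one, map_inv₀, hι, inv_neg,
        TensorProduct.tmul_neg]
      rw [← Algebra.TensorProduct.one_def]
      generalize (s ⊗ₜ[F] u⁻¹ : A ⊗[F] K) = x
      match_scalars <;> field_simp <;> norm_num
  exact ⟨key, _, key _ rfl⟩
end

section
/- Let F be a field of characteristic different from 2, let A be a central simple F-algebra of degree m (i.e., dim_F A = m²) and let σ be an involution of the first kind on A. Let a ∈ F^× be a nonsquare, K = F(u) with u² = a, ι the nontrivial F-automorphism of K, and (B,τ) = (A ⊗_F K, σ ⊗ ι). Suppose (B,τ) is hyperbolic, and suppose we are NOT in the exceptional case where simultaneously A is split (A ≅ M_m(F) as F-algebras), m ≡ 2 (mod 4), and σ is symplectic (i.e., dim_F {x ∈ A : σ(x) = x} = m(m−1)/2). Then there exists s ∈ A with σ(s) = s and s² = a·1. -/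
open scoped TensorProduct

namespace HypSq

section ring
variable {A : Type*} [Ring A]

theorem prime_of_simple [IsSimpleRing A] {x y : A} (hx : x ≠ 0) (hy : y ≠ 0) :
    ∃ t, x * t * y ≠ 0 := by
  by_contra! h
  let I : TwoSidedIdeal A := TwoSidedIdeal.mk' {s | ∀ t, s * t * y = 0}
    (by intro t; simp)
    (by intro s s' hs hs' t; rw [add_mul, add_mul, hs t, hs' t, add_zero])
    (by intro s hs t; rw [neg_mul, neg_mul, hs t, neg_zero])
    (by intro r s hs t; rw [mul_assoc r s t, mul_assoc r, hs t, mul_zero])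
    (by intro s r hs t; rw [mul_assoc s r t]; exact hs _)
  have h1 : (1 : A) ∈ I := IsSimpleRing.one_mem_of_ne_zero_mem I hx (by
    rw [TwoSidedIdeal.mem_mk']; exact h)
  rw [TwoSidedIdeal.mem_mk'] at h1
  exact hy (by simpa using h1 1)

/-- A primitive idempotent. -/
def Prim (e : A) : Prop :=
  e * e = e ∧ e ≠ 0 ∧ ∀ x, x * e = x → x ≠ 0 → ∃ y, y * x = e

theorem Prim.right [IsSimpleRing A] {e : A} (he : Prim e) {x : A} (hx : e * x = x)
    (hx0 : x ≠ 0) : ∃ y, x * y = e := by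
  obtain ⟨hee, he0, hl⟩ := he
  obtain ⟨t, ht⟩ := prime_of_simple hx0 he0
  obtain ⟨y, hy⟩ := hl (x * t * e) (by rw [mul_assoc _ e e, hee]) ht
  have hd : e * (x * t * e) = x * t * e := by rw [← mul_assoc, ← mul_assoc, hx]
  set d := x * t * e with hdd
  have hy1 : (e * y * e) * d = e := by rw [mul_assoc, hd, mul_assoc, hy, hee]
  obtain ⟨y', hy'⟩ := hl (e * y * e) (by rw [mul_assoc, hee]) (by
    intro h0; rw [h0, zero_mul] at hy1; exact he0 hy1.symm)
  have h3 : y' * e = d := by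
    rw [← hy1, ← mul_assoc, hy', hd]
  refine ⟨t * e * (e * y * e), ?_⟩
  calc x * (t * e * (e * y * e)) = d * (e * y * e) := by rw [hdd]; simp only [mul_assoc]
    _ = y' * (e * e) * y * e := by rw [← h3]; simp only [mul_assoc]
    _ = y' * (e * y * e) := by rw [hee]; simp only [mul_assoc]
    _ = e := hy'

theorem Prim.iso [IsSimpleRing A] {e e' : A} (he : Prim e) (he' : Prim e') {x : A}
    (h1 : x * e = x) (h2 : e' * x = x) (hx : x ≠ 0) :
    ∃ y, y * x = e ∧ x * y = e' ∧ e * y = y ∧ y * e' = y := by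
  obtain ⟨y, hy⟩ := he.2.2 x h1 hx
  obtain ⟨z, hz⟩ := he'.right h2 hx
  have hA : (e * y * e') * x = e := by rw [mul_assoc, h2, mul_assoc, hy, he.1]
  have hB : (e * y * e') * e' = e * y * e' := by rw [mul_assoc, he'.1]
  have hC : e * y * e' = e * z := by
    rw [← hB]; nth_rewrite 2 [← hz]; rw [← mul_assoc, hA]
  refine ⟨e * y * e', hA, ?_, ?_, hB⟩
  · rw [hC, ← mul_assoc, h1, hz]
  · rw [← mul_assoc, ← mul_assoc, he.1]

theorem Prim.exists_iso [IsSimpleRing A] {e e' : A} (he : Prim e) (he' : Prim e') :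
    ∃ p q, q * p = e ∧ p * q = e' ∧ p * e = p ∧ e' * p = p ∧ e * q = q ∧ q * e' = q := by
  obtain ⟨t, ht⟩ := prime_of_simple he'.2.1 he.2.1
  have h1 : e' * t * e * e = e' * t * e := by rw [mul_assoc, he.1]
  have h2 : e' * (e' * t * e) = e' * t * e := by rw [← mul_assoc, ← mul_assoc, he'.1]
  obtain ⟨y, a1, a2, a3, a4⟩ := he.iso he' h1 h2 ht
  exact ⟨_, y, a1, a2, h1, h2, a3, a4⟩

theorem exists_prim_le [IsSemisimpleRing A] {g : A} (hg : g * g = g) (hg0 : g ≠ 0) :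
    ∃ e, Prim e ∧ g * e = e ∧ e * g = e := by
  have hne : Ideal.span {g} ≠ (⊥ : Ideal A) := by
    rw [Ne, Ideal.span_singleton_eq_bot]; exact hg0
  obtain ⟨L, hL, hLg⟩ := (eq_bot_or_exists_atom_le (Ideal.span {g})).resolve_left hne
  obtain ⟨e, he, heL⟩ := IsSemisimpleRing.ideal_eq_span_idempotent L
  have hee : e * e = e := he
  have he0 : e ≠ 0 := by
    rintro rfl
    exact hL.1 (by rw [heL, Ideal.span_singleton_eq_bot])
  have hemem : e ∈ L := by rw [heL]; exact Ideal.mem_span_singleton_self e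
  obtain ⟨r, hr⟩ := Ideal.mem_span_singleton'.1 (hLg hemem)
  have heg : e * g = e := by rw [← hr, mul_assoc, hg]
  have hge0 : g * e ≠ 0 := by
    intro h0
    apply he0
    calc e = (e * g) * e := by rw [heg, hee]
      _ = 0 := by rw [mul_assoc, h0, mul_zero]
  have hLge : g * e ∈ L := L.mul_mem_left g hemem
  refine ⟨g * e, ⟨?_, hge0, ?_⟩, ?_, ?_⟩
  · calc g * e * (g * e) = g * ((e * g) * e) := by simp only [mul_assoc]
      _ = g * e := by rw [heg, hee]
  · intro x hx hx0
    have hxL : x ∈ L := by rw [← hx]; exact L.mul_mem_left x hLge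
    have hle : Ideal.span {x} ≤ L := (Ideal.span_singleton_le_iff_mem L).2 hxL
    have hne' : Ideal.span {x} ≠ (⊥ : Ideal A) := by
      rw [Ne, Ideal.span_singleton_eq_bot]; exact hx0
    have heq : Ideal.span {x} = L := by
      by_contra hcon
      exact hne' (hL.2 _ (lt_of_le_of_ne hle hcon))
    rw [← heq] at hLge
    exact Ideal.mem_span_singleton'.1 hLge
  · rw [← mul_assoc, hg]
  · rw [mul_assoc, heg]

/-- `Rk e k`: the element `e` is a sum of `k` orthogonal primitive idempotents. -/
inductive Rk : A → ℕ → Prop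
  | zero : Rk 0 0
  | succ (e e1 : A) (k : ℕ) : Rk e k → Prim e1 → e * e1 = 0 → e1 * e = 0 → Rk (e + e1) (k + 1)

theorem Rk.idem {e : A} {k : ℕ} (h : Rk e k) : e * e = e := by
  induction h with
  | zero => simp
  | succ e e1 k _ hp h1 h2 ih => simp [mul_add, add_mul, ih, h1, h2, hp.1]

theorem Rk.add {e e' : A} {k k' : ℕ} (h : Rk e k) (h' : Rk e' k') (h1 : e * e' = 0)
    (h2 : e' * e = 0) : Rk (e + e') (k + k') := by
  induction h' with
  | zero => simpa using h
  | succ f f1 l hf hp g1 g2 ih =>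
    have hff := hf.idem
    have a1 : e * f = 0 := by
      have : e * (f + f1) * f = 0 := by rw [h1, zero_mul]
      rwa [mul_add, add_mul, mul_assoc e f f, hff, mul_assoc e f1, g2, mul_zero, add_zero] at this
    have a2 : f * e = 0 := by
      have : f * ((f + f1) * e) = 0 := by rw [h2, mul_zero]
      rwa [add_mul, mul_add, ← mul_assoc f f, hff, ← mul_assoc f f1, g1, zero_mul, add_zero] at this
    have a3 : e * f1 = 0 := by rw [mul_add, a1, zero_add] at h1; exact h1
    have a4 : f1 * e = 0 := by rw [add_mul, a2, zero_add] at h2; exact h2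
    rw [← add_assoc, ← add_assoc]
    exact Rk.succ _ _ _ (ih a1 a2) hp (by rw [add_mul, a3, g1, add_zero])
      (by rw [mul_add, a4, g2, add_zero])

theorem Rk.matrixUnits [IsSimpleRing A] {e0 : A} (h0 : Prim e0) {e : A} {k : ℕ} (h : Rk e k) :
    ∃ p q : Fin k → A, (∑ i, p i * q i = e) ∧ (∀ i j, q i * p j = if i = j then e0 else 0) ∧
      (∀ i, p i * e0 = p i) ∧ (∀ i, e0 * q i = q i) ∧ (∀ i, e * p i = p i) ∧
      (∀ i, q i * e = q i) := by
  induction h with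
  | zero => exact ⟨Fin.elim0, Fin.elim0, by simp, fun i => i.elim0, fun i => i.elim0,
      fun i => i.elim0, fun i => i.elim0, fun i => i.elim0⟩
  | succ e e1 k hk hp h1 h2 ih =>
    obtain ⟨p, q, hs, hpq, hpe, hqe, hep, heq⟩ := ih
    obtain ⟨x, y, b1, b2, b3, b4, b5, b6⟩ := h0.exists_iso hp
    have c1 : e * x = 0 := by rw [← b4, ← mul_assoc, h1, zero_mul]
    have c2 : y * e = 0 := by rw [← b6, mul_assoc, h2, mul_zero]
    have c3 : ∀ i, e1 * p i = 0 := fun i => by rw [← hep, ← mul_assoc, h2, zero_mul]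
    have c4 : ∀ i, q i * e1 = 0 := fun i => by rw [← heq, mul_assoc, h1, mul_zero]
    refine ⟨Fin.snoc p x, Fin.snoc q y, ?_, ?_, ?_, ?_, ?_, ?_⟩
    · simp [Fin.sum_univ_castSucc, hs, b2]
    · intro i j
      refine Fin.lastCases ?_ (fun i => ?_) i <;> refine Fin.lastCases ?_ (fun j => ?_) j
      · simp [b1]
      · have : y * p j = 0 := by rw [← hep, ← mul_assoc, c2, zero_mul]
        simp [this, (Fin.castSucc_lt_last j).ne']
      · have : q i * x = 0 := by rw [← heq, mul_assoc, c1, mul_zero]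
        simp [this, (Fin.castSucc_lt_last i).ne]
      · simp [hpq, Fin.castSucc_inj]
    · intro i
      refine Fin.lastCases ?_ (fun i => ?_) i <;> simp [b3, hpe]
    · intro i
      refine Fin.lastCases ?_ (fun i => ?_) i <;> simp [b5, hqe]
    · intro i
      refine Fin.lastCases ?_ (fun i => ?_) i <;> simp [add_mul, b4, c1, c3, hep]
    · intro i
      refine Fin.lastCases ?_ (fun i => ?_) i <;> simp [mul_add, b6, c2, c4, heq]

end ring

section inv
variable {F A : Type*} [Field F] [Ring A] [Algebra F A]

/-- `σ` is an involution of the first kind. -/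
structure IsInvo (σ : A →ₗ[F] A) : Prop where
  mul : ∀ x y : A, σ (x * y) = σ y * σ x
  inv : ∀ x : A, σ (σ x) = x

variable {σ : A →ₗ[F] A}

theorem IsInvo.one (hσ : IsInvo σ) : σ 1 = 1 := by
  have h := hσ.mul (σ 1) 1
  rw [mul_one, hσ.inv, mul_one] at h
  exact h.symm

theorem IsInvo.ne (hσ : IsInvo σ) {x : A} (hx : x ≠ 0) : σ x ≠ 0 := by
  intro h
  apply hx
  rw [← hσ.inv x, h, map_zero]

theorem IsInvo.prim [IsSimpleRing A] (hσ : IsInvo σ) {e : A} (he : Prim e) : Prim (σ e) := by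
  refine ⟨by rw [← hσ.mul, he.1], hσ.ne he.2.1, fun x hx hx0 => ?_⟩
  obtain ⟨y, hy⟩ := he.right (x := σ x) (by
    rw [← hσ.inv e, ← hσ.mul, hx]) (hσ.ne hx0)
  exact ⟨σ y, by rw [← hy, hσ.mul, hσ.inv]⟩

theorem IsInvo.rk [IsSimpleRing A] (hσ : IsInvo σ) {e : A} {k : ℕ} (h : Rk e k) :
    Rk (σ e) k := by
  induction h with
  | zero => rw [map_zero]; exact Rk.zero
  | succ e e1 k _ hp h1 h2 ih =>
    rw [map_add]
    exact Rk.succ _ _ _ ih (hσ.prim hp) (by rw [← hσ.mul, h2, map_zero])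
      (by rw [← hσ.mul, h1, map_zero])

/-- there is a symmetric invertible element from `e` to `σ e`. -/
def Inv (σ : A →ₗ[F] A) (e : A) : Prop :=
  ∃ c b, σ c = c ∧ σ b = b ∧ b * c = e ∧ c * b = σ e ∧ c * e = c ∧ σ e * c = c ∧
    e * b = b ∧ b * σ e = b

theorem mz {x y e f : A} (hx : x * e = x) (hy : f * y = y) (h : e * f = 0) : x * y = 0 := by
  rw [← hx, ← hy, mul_assoc, ← mul_assoc e, h, zero_mul, mul_zero]

theorem Inv.add (hσ : IsInvo σ) {e e' : A} (h : Inv σ e) (h' : Inv σ e') (h1 : e * e' = 0)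
    (h2 : e' * e = 0) : Inv σ (e + e') := by
  obtain ⟨c, b, a1, a2, a3, a4, a5, a6, a7, a8⟩ := h
  obtain ⟨c', b', a1', a2', a3', a4', a5', a6', a7', a8'⟩ := h'
  have g1 : σ e * σ e' = 0 := by rw [← hσ.mul, h2, map_zero]
  have g2 : σ e' * σ e = 0 := by rw [← hσ.mul, h1, map_zero]
  have ee : e * e = e := by nth_rewrite 2 [← a3]; rw [← mul_assoc, a7, a3]
  have ee' : e' * e' = e' := by nth_rewrite 2 [← a3']; rw [← mul_assoc, a7', a3']
  have se : σ e * σ e = σ e := by rw [← hσ.mul, ee]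
  have se' : σ e' * σ e' = σ e' := by rw [← hσ.mul, ee']
  refine ⟨c + c', b + b', by simp [a1, a1'], by simp [a2, a2'], ?_, ?_, ?_, ?_, ?_, ?_⟩
  · simp [mul_add, add_mul, a3, a3', mz a8 a6' g1, mz a8' a6 g2]
  · simp [mul_add, add_mul, a4, a4', mz a5 a7' h1, mz a5' a7 h2]
  · simp [mul_add, add_mul, a5, a5', mz a5 ee' h1, mz a5' ee h2]
  · simp [mul_add, add_mul, a6, a6', mz se a6' g1, mz se' a6 g2]
  · simp [mul_add, add_mul, a7, a7', mz ee a7' h1, mz ee' a7 h2]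
  · simp [mul_add, add_mul, a8, a8', mz a8 se' g1, mz a8' se g2]

theorem Inv.zero : Inv σ 0 := ⟨0, 0, by simp⟩

theorem inv_pair [IsSimpleRing A] (hσ : IsInvo σ) {e1 e2 : A} (he1 : Prim e1) (he2 : Prim e2)
    (h12 : e1 * e2 = 0) (h21 : e2 * e1 = 0) : Inv σ (e1 + e2) := by
  obtain ⟨x, y, a1, a2, a3, a4, a5, a6⟩ := he1.exists_iso (hσ.prim he2)
  have s12 : σ e1 * σ e2 = 0 := by rw [← hσ.mul, h21, map_zero]
  have s21 : σ e2 * σ e1 = 0 := by rw [← hσ.mul, h12, map_zero]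
  have b1 : σ x * σ y = σ e1 := by rw [← hσ.mul, a1]
  have b2 : σ y * σ x = e2 := by rw [← hσ.mul, a2, hσ.inv]
  have b3 : σ e1 * σ x = σ x := by rw [← hσ.mul, a3]
  have b4 : σ x * e2 = σ x := by nth_rewrite 1 [← hσ.inv e2]; rw [← hσ.mul, a4]
  have b5 : σ y * σ e1 = σ y := by rw [← hσ.mul, a5]
  have b6 : e2 * σ y = σ y := by nth_rewrite 1 [← hσ.inv e2]; rw [← hσ.mul, a6]
  refine ⟨x + σ x, y + σ y, ?_, ?_, ?_, ?_, ?_, ?_, ?_, ?_⟩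
  · rw [map_add, hσ.inv, add_comm]
  · rw [map_add, hσ.inv, add_comm]
  · simp [mul_add, add_mul, a1, b2, mz a6 b3 s21, mz b5 a4 s12]
  · simp [mul_add, add_mul, a2, b1, mz a3 b6 h12, mz b4 a5 h21, add_comm]
  · simp [mul_add, add_mul, a3, b4, mz a3 he2.1 h12, mz b4 he1.1 h21]
  · simp [mul_add, add_mul, a4, b3, mz (hσ.prim he1).1 a4 s12, mz (hσ.prim he2).1 b3 s21]
  · simp [mul_add, add_mul, a5, b6, mz he1.1 b6 h12, mz he2.1 a5 h21]
  · simp [mul_add, add_mul, a6, b5, mz a6 (hσ.prim he1).1 s21, mz b5 (hσ.prim he2).1 s12, add_comm]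

theorem inv_prim [IsSimpleRing A] (hσ : IsInvo σ) {e x : A} (he : Prim e) (h1 : x * e = x)
    (h2 : σ e * x = x) (hx : σ x = x) (hx0 : x ≠ 0) : Inv σ e := by
  obtain ⟨y, a1, a2, a3, a4⟩ := he.iso (hσ.prim he) h1 h2 hx0
  refine ⟨x, y, hx, ?_, a1, a2, h1, h2, a3, a4⟩
  have b1 : x * σ y = σ e := by nth_rewrite 1 [← hx]; rw [← hσ.mul, a1]
  have b2 : e * σ y = σ y := by nth_rewrite 1 [← hσ.inv e]; rw [← hσ.mul, a4]
  rw [← b2, ← a1, mul_assoc, b1, a4]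

theorem Inv.sqrt (hσ : IsInvo σ) {e : A} (h : Inv σ e) (h1 : e * σ e = 0) (h2 : σ e * e = 0)
    (a : F) : ∃ s, σ s = s ∧ s * s = a • (e + σ e) ∧ s * (e + σ e) = s ∧ (e + σ e) * s = s := by
  obtain ⟨c, b, a1, a2, a3, a4, a5, a6, a7, a8⟩ := h
  have ee : e * e = e := by nth_rewrite 2 [← a3]; rw [← mul_assoc, a7, a3]
  have se : σ e * σ e = σ e := by rw [← hσ.mul, ee]
  refine ⟨c + a • b, by simp [a1, a2], ?_, ?_, ?_⟩
  · simp [mul_add, add_mul, mz a5 a6 h1, mz a8 a7 h2, a3, a4, add_comm]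
  · simp [mul_add, add_mul, a5, mz a5 se h1, a8, mz a8 ee h2]
  · simp [mul_add, add_mul, a6, mz ee a6 h1, a7, mz se a7 h2]

theorem Rk.inv_even [IsSimpleRing A] (hσ : IsInvo σ) : ∀ (k : ℕ) (e : A), Rk e (2 * k) → Inv σ e
  | 0, e, h => by
    cases h
    exact Inv.zero
  | k + 1, e, h => by
    have h' : Rk e (2 * k + 1 + 1) := h
    cases h' with
    | succ f f1 _ hf hp g1 g2 =>
      cases hf with
      | succ d d1 _ hd hp' g1' g2' =>
        have dd := hd.idem
        have k1 : d * f1 = 0 := by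
          have : d * ((d + d1) * f1) = 0 := by rw [g1, mul_zero]
          rwa [← mul_assoc, mul_add, dd, g1', add_zero] at this
        have k2 : f1 * d = 0 := by
          have : f1 * (d + d1) * d = 0 := by rw [g2, zero_mul]
          rwa [mul_assoc, add_mul, dd, g2', add_zero] at this
        have k3 : d1 * f1 = 0 := by rwa [add_mul, k1, zero_add] at g1
        have k4 : f1 * d1 = 0 := by rwa [mul_add, k2, zero_add] at g2
        rw [add_assoc]
        exact Inv.add hσ (Rk.inv_even hσ k d hd) (inv_pair hσ hp' hp k3 k4)
          (by rw [mul_add, g1', k1, add_zero]) (by rw [add_mul, g2', k2, add_zero])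

theorem idem_sub {g e : A} (hg : g * g = g) (he : e * e = e) (h1 : g * e = e) (h2 : e * g = e) :
    (g - e) * (g - e) = g - e ∧ (g - e) * e = 0 ∧ e * (g - e) = 0 := by
  simp [mul_sub, sub_mul, hg, he, h1, h2]

/-- Strong induction on idempotents. -/
theorem idem_induction [IsSemisimpleRing A] (P : A → Prop)
    (step : ∀ g : A, g * g = g →
      (∀ f, f * f = f → g * f = f → f * g = f → f ≠ g → P f) → P g) :
    ∀ g : A, g * g = g → P g := by
  have key : ∀ I : Ideal A, ∀ g : A, g * g = g → Ideal.span {g} = I → P g := by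
    intro I
    induction I using WellFoundedLT.induction with
    | ind I ih =>
      intro g hg hI
      refine step g hg fun f hf h1 h2 hne => ?_
      refine ih (Ideal.span {f}) ?_ f hf rfl
      rw [← hI]
      refine lt_of_le_of_ne ?_ ?_
      · rw [Ideal.span_singleton_le_iff_mem, Ideal.mem_span_singleton']
        exact ⟨f, h2⟩
      · intro heq
        apply hne
        have : g ∈ Ideal.span {f} := by rw [heq]; exact Ideal.mem_span_singleton_self g
        obtain ⟨r, hr⟩ := Ideal.mem_span_singleton'.1 this
        rw [← h1, ← hr, mul_assoc, hf]
  intro g hg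
  exact key _ g hg rfl

theorem inv_all [IsSimpleRing A] [IsSemisimpleRing A] (hσ : IsInvo σ)
    (hgood : ∀ e : A, Prim e → ∃ x, x * e = x ∧ σ e * x = x ∧ σ x = x ∧ x ≠ 0) :
    ∀ g : A, g * g = g → Inv σ g := by
  refine idem_induction _ fun g hg ih => ?_
  by_cases hg0 : g = 0
  · rw [hg0]; exact Inv.zero
  obtain ⟨e, he, h1, h2⟩ := exists_prim_le hg hg0
  obtain ⟨i1, i2, i3⟩ := idem_sub hg he.1 h1 h2
  obtain ⟨x, x1, x2, x3, x4⟩ := hgood e he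
  have hI := ih (g - e) i1 (by rw [mul_sub, hg, h1]) (by rw [sub_mul, hg, h2])
    (fun h => he.2.1 (by simpa using h))
  have := Inv.add hσ hI (inv_prim hσ he x1 x2 x3 x4) i2 i3
  rwa [sub_add_cancel] at this

/-- all elements of `σ e A e` are skew. -/
def Bad (σ : A →ₗ[F] A) (e : A) : Prop := ∀ x, x * e = x → σ e * x = x → σ x = -x

theorem Bad.transfer [IsSimpleRing A] (hσ : IsInvo σ) {e0 e : A} (h0 : Prim e0)
    (hb : Bad σ e0) (he : Prim e) : Bad σ e := by
  obtain ⟨p, q, a1, a2, a3, a4, a5, a6⟩ := h0.exists_iso he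
  intro x hx1 hx2
  have b1 : σ e0 * σ p = σ p := by rw [← hσ.mul, a3]
  have b2 : σ q * σ p = σ e := by rw [← hσ.mul, a2]
  have h := hb (σ p * x * p) (by rw [mul_assoc, a3]) (by rw [← mul_assoc, ← mul_assoc, b1])
  have hx : x = σ q * (σ p * x * p) * q := by
    calc x = σ e * x * e := by rw [hx2, hx1]
      _ = σ q * (σ p * x * p) * q := by rw [← b2, ← a2]; simp only [mul_assoc]
  have hσx : σ x = σ q * σ (σ p * x * p) * q := by
    nth_rewrite 1 [hx]
    rw [hσ.mul, hσ.mul (σ q), hσ.inv]; simp only [mul_assoc]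
  rw [hσx, h, mul_neg, neg_mul, ← hx]

theorem eq_zero_of_neg (h2 : (2 : F) ≠ 0) {x : A} (h : x = -x) : x = 0 := by
  have h' : (2 : F) • x = 0 := by
    rw [two_smul]; nth_rewrite 2 [h]; simp
  exact (smul_eq_zero.1 h').resolve_left h2

theorem Bad.orth [IsSimpleRing A] (h2 : (2 : F) ≠ 0) (hσ : IsInvo σ) {e : A} (he : Prim e)
    (hb : Bad σ e) : e * σ e = 0 ∧ σ e * e = 0 := by
  have hs := (hσ.prim he)
  refine ⟨?_, ?_⟩
  · by_contra hne
    obtain ⟨c, a1, a2, a3, a4⟩ := hs.iso he (x := e * σ e) (by rw [mul_assoc, hs.1])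
      (by rw [← mul_assoc, he.1]) hne
    have hc := hb c a4 a3
    have hσb : σ (e * σ e) = e * σ e := by rw [hσ.mul, hσ.inv]
    set b := e * σ e with hbd
    have k : b * σ c = e := by
      nth_rewrite 1 [← hσb]; rw [← hσ.mul, a1, hσ.inv]
    rw [hc, mul_neg, a2] at k
    exact he.2.1 (eq_zero_of_neg h2 k.symm)
  · have := hb (σ e * e) (by rw [mul_assoc, he.1]) (by rw [← mul_assoc, hs.1])
    rw [hσ.mul, hσ.inv] at this
    exact eq_zero_of_neg h2 this

theorem bad_decomp [IsSimpleRing A] [IsSemisimpleRing A] (h2 : (2 : F) ≠ 0) (hσ : IsInvo σ)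
    (hbad : ∀ e : A, Prim e → Bad σ e) : ∀ g : A, g * g = g → σ g = g →
      ∃ e k, Rk e k ∧ e + σ e = g ∧ e * σ e = 0 ∧ σ e * e = 0 := by
  refine idem_induction _ fun g hg ih hsg => ?_
  by_cases hg0 : g = 0
  · exact ⟨0, 0, Rk.zero, by simp [hg0], by simp, by simp⟩
  obtain ⟨e, he, h1, h3⟩ := exists_prim_le hg hg0
  obtain ⟨o1, o2⟩ := (hbad e he).orth h2 hσ he
  have s1 : σ e * g = σ e := by nth_rewrite 1 [← hsg]; rw [← hσ.mul, h1]
  have s3 : g * σ e = σ e := by nth_rewrite 1 [← hsg]; rw [← hσ.mul, h3]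
  have se := (hσ.prim he).1
  set d := e + σ e with hd
  have hdd : d * d = d := by simp [hd, mul_add, add_mul, he.1, se, o1, o2]
  have hgd : g * d = d := by rw [hd, mul_add, h1, s3]
  have hdg : d * g = d := by rw [hd, add_mul, h3, s1]
  have hed : e * d = e := by rw [hd, mul_add, he.1, o1, add_zero]
  have hde : d * e = e := by rw [hd, add_mul, he.1, o2, add_zero]
  have hd0 : d ≠ 0 := fun h => he.2.1 (by rw [← hed, h, mul_zero])
  have hsd : σ d = d := by rw [hd, map_add, hσ.inv, add_comm]
  obtain ⟨i1, i2, i3⟩ := idem_sub hg hdd hgd hdg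
  obtain ⟨f, k, hf, f1, f2, f3⟩ := ih (g - d) i1 (by rw [mul_sub, hg, hgd])
    (by rw [sub_mul, hg, hdg]) (fun h => hd0 (by simpa using h)) (by rw [map_sub, hsg, hsd])
  have ff := hf.idem
  have fl : f * (g - d) = f := by rw [← f1, mul_add, ff, f2, add_zero]
  have fr : (g - d) * f = f := by rw [← f1, add_mul, ff, f3, add_zero]
  have sfl : σ f * (g - d) = σ f := by
    rw [← f1, mul_add, ← hσ.mul, ff, f3, zero_add]
  have sfr : (g - d) * σ f = σ f := by
    rw [← f1, add_mul, ← hσ.mul, ff, f2, zero_add]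
  have dse : d * σ e = σ e := by rw [hd, add_mul, se, o1, zero_add]
  have sed : σ e * d = σ e := by rw [hd, mul_add, se, o2, zero_add]
  refine ⟨f + e, k + 1, Rk.succ _ _ _ hf he (mz fl hde i2) (mz hed fr i3), ?_, ?_, ?_⟩
  · have : f + e + σ (f + e) = (f + σ f) + d := by rw [hd, map_add]; abel
    rw [this, f1, sub_add_cancel]
  · simp [mul_add, add_mul, f2, o1, mz fl dse i2, mz hed sfr i3]
  · simp [mul_add, add_mul, f3, o2, mz sfl hde i2, mz sed fr i3]

end inv

section badcase
variable {F A : Type*} [Field F] [Ring A] [Algebra F A] {σ : A →ₗ[F] A}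

/-- skew-symmetric matrices -/
def skewMat (F : Type*) [Field F] (n : ℕ) : Submodule F (Matrix (Fin n) (Fin n) F) where
  carrier := {M | ∀ i j, M i j = -M j i}
  add_mem' := by
    intro M N hM hN i j
    rw [Matrix.add_apply, Matrix.add_apply, hM i j, hN i j]; ring
  zero_mem' := by intro i j; simp
  smul_mem' := by
    intro c M hM i j
    rw [Matrix.smul_apply, Matrix.smul_apply, hM i j, smul_neg]

theorem finrank_skewMat (h2 : (2 : F) ≠ 0) (n : ℕ) :
    Module.finrank F (skewMat F n) = n * (n - 1) / 2 := by
  let P := (i : Fin n) × {j : Fin n // j < i}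
  have hcard : Fintype.card P = n * (n - 1) / 2 := by
    rw [Fintype.card_sigma, ← Finset.sum_range_id, ← Fin.sum_univ_eq_sum_range]
    refine Finset.sum_congr rfl fun i _ => ?_
    rw [Fintype.card_subtype, ← Fin.card_Iio i]
    congr 1
    ext j; simp
  let Φ : (skewMat F n) →ₗ[F] (P → F) :=
    { toFun := fun M p => M.1 p.1 p.2.1
      map_add' := fun M N => rfl
      map_smul' := fun c M => rfl }
  have hbij : Function.Bijective Φ := by
    refine ⟨?_, ?_⟩
    · rw [injective_iff_map_eq_zero]
      intro M hM
      have hlt : ∀ i j, j < i → M.1 i j = 0 := fun i j h => congrFun hM ⟨i, j, h⟩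
      ext i j
      rcases lt_trichotomy i j with h | h | h
      · rw [M.2 i j, hlt j i h]; simp
      · subst h
        have h3 : M.1 i i = -M.1 i i := M.2 i i
        have h4 : (2 : F) * M.1 i i = 0 := by linear_combination h3
        simpa [h2] using h4
      · rw [hlt i j h]; simp
    · intro v
      refine ⟨⟨Matrix.of fun i j => if h : j < i then v ⟨i, j, h⟩ else
        if h : i < j then - v ⟨j, i, h⟩ else 0, ?_⟩, ?_⟩
      · intro i j
        rcases lt_trichotomy i j with h | h | h
        · simp [h, h.not_gt]
        · simp [h]
        · simp [h, h.not_gt]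
      · ext ⟨i, j, h⟩
        change (if h : j < i then v ⟨i, j, h⟩ else
          if h : i < j then - v ⟨j, i, h⟩ else 0) = v ⟨i, j, h⟩
        rw [dif_pos h]
  rw [(LinearEquiv.ofBijective Φ hbij).finrank_eq, Module.finrank_fintype_fun_eq_card, hcard]

theorem Bad.comm [IsSimpleRing A] (hσ : IsInvo σ) {e : A} (he : Prim e)
    (hb : Bad σ e) : ∃ c w, w * c = e ∧ c * w = σ e ∧ c * e = c ∧ σ e * c = c ∧ e * w = w ∧
      w * σ e = w ∧ σ w = -w ∧ ∀ d d', d * e = d → e * d = d → d' * e = d' → e * d' = d' →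
        d * d' = d' * d := by
  obtain ⟨c, w, a1, a2, a3, a4, a5, a6⟩ := he.exists_iso (hσ.prim he)
  have hc := hb c a3 a4
  refine ⟨c, w, a1, a2, a3, a4, a5, a6, ?_, ?_⟩
  · have h1 : σ c * σ w = σ e := by rw [← hσ.mul, a1]
    rw [hc, neg_mul] at h1
    have h2 : e * σ w = σ w := by nth_rewrite 1 [← hσ.inv e]; rw [← hσ.mul, a6]
    rw [← h2, ← a1, mul_assoc, ← neg_eq_iff_eq_neg, ← mul_neg, h1, a6]
  · have key : ∀ d, d * e = d → e * d = d → σ d * c = c * d := by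
      intro d h1 h2
      have h := hb (c * d) (by rw [mul_assoc, h1]) (by rw [← mul_assoc, a4])
      rwa [hσ.mul, hc, mul_neg, neg_inj] at h
    intro d d' h1 h2 h3 h4
    have h5 : c * (d * d') = c * (d' * d) := by
      rw [← key (d * d') (by rw [mul_assoc, h3]) (by rw [← mul_assoc, h2]), hσ.mul, mul_assoc,
        key d h1 h2, ← mul_assoc, key d' h3 h4, mul_assoc]
    have h6 : w * (c * (d * d')) = w * (c * (d' * d)) := by rw [h5]
    rwa [← mul_assoc w, ← mul_assoc w, a1, ← mul_assoc, ← mul_assoc, h2, h4] at h6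

theorem scalar_of_comm [Algebra.IsCentral F A] {e : A} {n : ℕ} {p q : Fin n → A}
    (h1 : ∑ i, p i * q i = 1) (hp : ∀ i, p i * e = p i) (hq : ∀ i, e * q i = q i)
    (hee : e * e = e)
    (hcomm : ∀ d d', d * e = d → e * d = d → d' * e = d' → e * d' = d' → d * d' = d' * d)
    {d : A} (hd1 : d * e = d) (hd2 : e * d = d) : ∃ l : F, d = l • e := by
  have hin : ∀ x i j, d * (q i * x * p j) = (q i * x * p j) * d := fun x i j =>
    hcomm _ _ hd1 hd2 (by rw [mul_assoc, hp]) (by rw [← mul_assoc, ← mul_assoc, hq])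
  have hcen : ∑ i, p i * d * q i ∈ Subalgebra.center F A := by
    rw [Subalgebra.mem_center_iff]
    intro t
    calc t * ∑ i, p i * d * q i = (∑ j, p j * q j) * (t * ∑ i, p i * d * q i) := by
          rw [h1, one_mul]
      _ = ∑ j, ∑ i, p j * ((q j * t * p i) * d) * q i := by
          simp only [Finset.sum_mul, Finset.mul_sum, mul_assoc]
          rw [Finset.sum_comm]
      _ = ∑ j, ∑ i, p j * (d * (q j * t * p i)) * q i := by
          simp only [hin]
      _ = ((∑ i, p i * d * q i) * t) * (∑ j, p j * q j) := by
          simp only [Finset.sum_mul, Finset.mul_sum, mul_assoc]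
          rw [Finset.sum_comm]
      _ = _ := by rw [h1, mul_one]
  have hb := Algebra.IsCentral.out hcen
  obtain ⟨l, hl⟩ := Algebra.mem_bot.1 hb
  refine ⟨l, ?_⟩
  have h3 : ∀ i, d * (e * p i) = (e * p i) * d := fun i =>
    hcomm _ _ hd1 hd2 (by rw [mul_assoc, hp]) (by rw [← mul_assoc, hee])
  calc d = d * e * (∑ i, p i * q i) := by rw [h1, mul_one, hd1]
    _ = ∑ i, (d * (e * p i)) * q i := by simp only [Finset.mul_sum, mul_assoc]
    _ = e * ∑ i, p i * d * q i := by simp only [h3, Finset.mul_sum, mul_assoc]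
    _ = l • e := by rw [← hl, ← Algebra.commutes, Algebra.smul_def]

theorem bad_final [IsSimpleRing A] [Algebra.IsCentral F A] [FiniteDimensional F A]
    (h2 : (2 : F) ≠ 0) (hσ : IsInvo σ) {e : A} (he : Prim e) (hb : Bad σ e)
    {n : ℕ} (hn : Rk (1 : A) n) :
    Nonempty (A ≃ₐ[F] Matrix (Fin n) (Fin n) F) ∧ Module.finrank F A = n ^ 2 ∧
      Module.finrank F (LinearMap.ker (σ - LinearMap.id)) = n * (n - 1) / 2 := by
  obtain ⟨c, w, a1, a2, a3, a4, a5, a6, a7, hcomm⟩ := hb.comm hσ he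
  obtain ⟨p, q, h1, hqp, hp, hq, -, -⟩ := hn.matrixUnits he
  have hw0 : w ≠ 0 := by rintro rfl; exact he.2.1 (by rw [← a1, zero_mul])
  have hscal : ∀ x i j, ∃ l : F, q i * x * p j = l • e := fun x i j =>
    scalar_of_comm h1 hp hq he.1 hcomm (by rw [mul_assoc, hp])
      (by rw [← mul_assoc, ← mul_assoc, hq])
  let Φ0 : Matrix (Fin n) (Fin n) F →ₗ[F] A :=
    { toFun := fun M => ∑ i, ∑ j, M i j • (p i * q j)
      map_add' := fun M N => by
        simp only [Matrix.add_apply, add_smul, Finset.sum_add_distrib]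
      map_smul' := fun r M => by
        simp only [Matrix.smul_apply, smul_assoc, Finset.smul_sum, RingHom.id_apply] }
  have hΦ0 : ∀ M, Φ0 M = ∑ i, ∑ j, M i j • (p i * q j) := fun M => rfl
  have hone : Φ0 1 = 1 := by
    rw [hΦ0, ← h1]
    simp [Matrix.one_apply, ite_smul]
  have hqΦ : ∀ M i j, q i * Φ0 M * p j = M i j • e := by
    intro M i j
    have : ∀ i' j', q i * (M i' j' • (p i' * q j')) * p j = M i' j' • ((q i * p i') * (q j' * p j)) := by
      intro i' j'; simp only [mul_smul_comm, smul_mul_assoc, mul_assoc]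
    rw [hΦ0]
    simp only [Finset.mul_sum, Finset.sum_mul, this, hqp]
    rw [Finset.sum_eq_single i, Finset.sum_eq_single j]
    · simp [he.1]
    · intro j' _ hj'; simp [hj']
    · simp
    · intro i' _ hi'; simp [hi'.symm]
    · simp
  have hrec : ∀ x : A, x = ∑ i, ∑ j, p i * (q i * x * p j) * q j := by
    intro x
    calc x = (∑ i, p i * q i) * x * (∑ j, p j * q j) := by rw [h1, one_mul, mul_one]
      _ = _ := by simp only [Finset.mul_sum, Finset.sum_mul, mul_assoc]; rw [Finset.sum_comm]
  have hext : ∀ x y : A, (∀ i j, q i * x * p j = q i * y * p j) → x = y := by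
    intro x y h
    rw [hrec x, hrec y]; simp only [h]
  have hmul : ∀ M N, Φ0 (M * N) = Φ0 M * Φ0 N := by
    intro M N
    apply hext
    intro i j
    rw [hqΦ]
    calc (M * N) i j • e = ∑ k, (q i * Φ0 M * p k) * (q k * Φ0 N * p j) := by
          simp only [hqΦ, Matrix.mul_apply, Finset.sum_smul, smul_mul_smul_comm, he.1]
      _ = q i * Φ0 M * (∑ k, p k * q k) * (Φ0 N * p j) := by
          simp only [Finset.mul_sum, Finset.sum_mul, mul_assoc]
      _ = _ := by rw [h1, mul_one]; simp only [mul_assoc]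
  let Φ : Matrix (Fin n) (Fin n) F →ₐ[F] A := AlgHom.ofLinearMap Φ0 hone hmul
  have hinj : Function.Injective Φ := by
    intro M N h
    ext i j
    have h' : Φ0 M = Φ0 N := h
    have := hqΦ M i j
    rw [h', hqΦ] at this
    exact (smul_left_injective F he.2.1 this).symm
  have hsurj : Function.Surjective Φ := by
    intro x
    choose l hl using hscal x
    refine ⟨Matrix.of l, ?_⟩
    change Φ0 _ = x
    apply hext
    intro i j
    rw [hqΦ, hl]; rfl
  let E := AlgEquiv.ofBijective Φ ⟨hinj, hsurj⟩
  have hfin : Module.finrank F A = n ^ 2 := by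
    rw [← E.toLinearEquiv.finrank_eq, Module.finrank_matrix]; simp [sq]
  refine ⟨⟨E.symm⟩, hfin, ?_⟩
  let Ψ : Matrix (Fin n) (Fin n) F →ₗ[F] A :=
    { toFun := fun M => ∑ i, ∑ j, M i j • (p i * w * σ (p j))
      map_add' := fun M N => by
        simp only [Matrix.add_apply, add_smul, Finset.sum_add_distrib]
      map_smul' := fun r M => by
        simp only [Matrix.smul_apply, smul_assoc, Finset.smul_sum, RingHom.id_apply] }
  have hΨ : ∀ M, Ψ M = ∑ i, ∑ j, M i j • (p i * w * σ (p j)) := fun M => rfl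
  have hsq : ∀ i j, σ (p i) * σ (q j) = if j = i then σ e else 0 := by
    intro i j
    rw [← hσ.mul, hqp]; split_ifs <;> simp
  have hqΨ : ∀ M i j, q i * Ψ M * σ (q j) = M i j • w := by
    intro M i j
    have : ∀ i' j', q i * (M i' j' • (p i' * w * σ (p j'))) * σ (q j) =
        M i' j' • ((q i * p i') * w * (σ (p j') * σ (q j))) := by
      intro i' j'; simp only [mul_smul_comm, smul_mul_assoc, mul_assoc]
    rw [hΨ]
    simp only [Finset.mul_sum, Finset.sum_mul, this, hqp, hsq]
    rw [Finset.sum_eq_single i, Finset.sum_eq_single j]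
    · simp [a5, a6]
    · intro j' _ hj'; simp [hj'.symm]
    · simp
    · intro i' _ hi'; simp [hi'.symm]
    · simp
  have hΨinj : Function.Injective Ψ := by
    intro M N h
    ext i j
    have := hqΨ M i j
    rw [h, hqΨ] at this
    exact (smul_left_injective F hw0 this).symm
  have hΨσ : ∀ M, σ (Ψ M) = - Ψ M.transpose := by
    intro M
    have : ∀ i j, σ (p i * w * σ (p j)) = -(p j * w * σ (p i)) := by
      intro i j
      rw [hσ.mul, hσ.mul, hσ.inv, a7]; simp [mul_assoc]
    simp only [hΨ, map_sum, map_smul, this, Matrix.transpose_apply, smul_neg,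
      Finset.sum_neg_distrib]
    rw [Finset.sum_comm]
  let EΨ := LinearEquiv.ofInjectiveOfFinrankEq Ψ hΨinj (by
    rw [hfin, Module.finrank_matrix]; simp [sq])
  have hEΨ : ∀ M, EΨ M = Ψ M := fun M => rfl
  have hker : LinearMap.ker (σ - LinearMap.id) = (skewMat F n).map (EΨ : _ →ₗ[F] A) := by
    ext x
    obtain ⟨M, rfl⟩ := EΨ.surjective x
    have hR : EΨ M ∈ (skewMat F n).map (EΨ : _ →ₗ[F] A) ↔ M ∈ skewMat F n := by
      constructor
      · rintro ⟨N, hN, h⟩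
        rwa [← EΨ.injective h]
      · intro h; exact ⟨M, h, rfl⟩
    rw [hR, LinearMap.mem_ker, LinearMap.sub_apply, LinearMap.id_apply, sub_eq_zero, hEΨ, hΨσ,
      ← map_neg]
    constructor
    · intro h i j
      have := congrFun (congrFun (hΨinj h) i) j
      exact this.symm
    · intro h
      congr 1
      ext i j
      exact (h i j).symm
  rw [hker, LinearEquiv.finrank_map_eq, finrank_skewMat h2]

end badcase

section good
open Polynomial
variable {F A : Type*} [Field F] [Ring A] [Algebra F A] {σ : A →ₗ[F] A}

theorem exists_inv_sqrt (h2 : (2 : F) ≠ 0) (a : F) (n : ℕ) :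
    ∃ p h : F[X], (1 - C a * X) * p ^ 2 = 1 + X ^ (n + 1) * h := by
  induction n with
  | zero => exact ⟨1, -C a, by ring⟩
  | succ n ih =>
    obtain ⟨p, h, hp⟩ := ih
    obtain ⟨t, ht⟩ : ∃ t : F[X], 2 * t = 1 := ⟨C (2⁻¹), by
      rw [show (2 : F[X]) = C 2 from rfl, ← C_mul, mul_inv_cancel₀ h2, C_1]⟩
    refine ⟨p * (1 - X ^ (n + 1) * h * t),
      X ^ n * h ^ 2 * (-1 + t ^ 2 + X ^ (n + 1) * h * t ^ 2), ?_⟩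
    set H := X ^ (n + 1) * h with hH
    have e1 : X ^ (n + 1 + 1) * (X ^ n * h ^ 2 * (-1 + t ^ 2 + H * t ^ 2)) =
        H ^ 2 * (-1 + t ^ 2 + H * t ^ 2) := by rw [hH]; ring
    rw [e1]
    linear_combination (1 - H * t) ^ 2 * hp - (H + H ^ 2) * ht

theorem aeval_symm (hσ : IsInvo σ) {w : A} (hw : σ w = w) (P : F[X]) :
    σ (aeval w P) = aeval w P := by
  have hpow : ∀ n : ℕ, σ (w ^ n) = w ^ n := by
    intro n
    induction n with
    | zero => simpa using hσ.one
    | succ n ih => rw [pow_succ, hσ.mul, ih, hw, ← pow_succ', pow_succ]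
  induction P using Polynomial.induction_on' with
  | add p q hp hq => rw [map_add, map_add, hp, hq]
  | monomial n c => rw [aeval_monomial, ← Algebra.smul_def, map_smul, hpow]

theorem aeval_comm {w z : A} (h : Commute z w) (P : F[X]) : Commute z (aeval w P) := by
  induction P using Polynomial.induction_on' with
  | add p q hp hq => rw [map_add]; exact hp.add_right hq
  | monomial n c =>
    rw [aeval_monomial]
    exact (Algebra.commute_algebraMap_right c z).mul_right (h.pow_right n)

theorem fitting_poly (h2 : (2 : F) ≠ 0) (a : F) (μ : F[X]) (hμ : μ ≠ 0) :
    ∃ f g k d : F[X], f + g = 1 ∧ μ ∣ f * g ∧ μ ∣ (1 - C a * X) * (k * k) - g ∧ μ ∣ k * f ∧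
      μ ∣ d * X - f ∧ μ ∣ d * g := by
  obtain ⟨q, hq, hqn⟩ := Polynomial.exists_eq_pow_rootMultiplicity_mul_and_not_dvd μ hμ 0
  rw [C_0, sub_zero] at hq hqn
  set r := rootMultiplicity 0 μ
  have hcop : IsCoprime (X ^ (r + 1)) q :=
    ((Polynomial.irreducible_X.coprime_iff_not_dvd).2 hqn).pow_left
  obtain ⟨α, β, hab⟩ := hcop
  obtain ⟨p, h, hp⟩ := exists_inv_sqrt h2 a r
  refine ⟨α * X ^ (r + 1), β * q, p * (β * q), α * X ^ r * (α * X ^ (r + 1)), hab, ?_, ?_, ?_,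
    ?_, ?_⟩ <;> rw [hq]
  · exact ⟨α * β * X, by ring⟩
  · refine ⟨X * h * β ^ 2 * q - α * β * X, ?_⟩
    linear_combination (β * q) ^ 2 * hp + β * q * hab
  · exact ⟨p * α * β * X, by ring⟩
  · refine ⟨-(α * β * X), ?_⟩
    linear_combination α * X ^ (r + 1) * hab
  · exact ⟨α * X ^ r * α * β * X, by ring⟩

theorem fitting_elts [FiniteDimensional F A] (h2 : (2 : F) ≠ 0) (hσ : IsInvo σ) (a : F) {w : A}
    (hw : σ w = w) : ∃ f g k d : A, f + g = 1 ∧ f * g = 0 ∧ g * f = 0 ∧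
      (1 - a • w) * (k * k) = g ∧ k * f = 0 ∧ f * k = 0 ∧ d * w = f ∧ w * d = f ∧ d * g = 0 ∧
      g * d = 0 ∧ σ f = f ∧ σ g = g ∧ σ k = k ∧ σ d = d ∧
      ∀ z, Commute z w → z * f = f * z ∧ z * g = g * z ∧ z * k = k * z ∧ z * d = d * z := by
  have hint : IsIntegral F w := Algebra.IsIntegral.isIntegral w
  obtain ⟨f, g, k, d, a1, a2, a3, a4, a5, a6⟩ :=
    fitting_poly h2 a (minpoly F w) (minpoly.ne_zero hint)
  have hdvd : ∀ P, minpoly F w ∣ P → aeval w P = 0 := fun P hP => by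
    obtain ⟨Q, rfl⟩ := hP
    rw [map_mul, minpoly.aeval, zero_mul]
  have hX : aeval w (X : F[X]) = w := aeval_X w
  have e5 := hdvd _ a5
  rw [map_sub, sub_eq_zero] at e5
  refine ⟨aeval w f, aeval w g, aeval w k, aeval w d, ?_, ?_, ?_, ?_, ?_, ?_, ?_, ?_, ?_, ?_,
    aeval_symm hσ hw f, aeval_symm hσ hw g, aeval_symm hσ hw k, aeval_symm hσ hw d, ?_⟩
  · rw [← map_add, a1, map_one]
  · rw [← map_mul, hdvd _ a2]
  · rw [← map_mul, mul_comm, hdvd _ a2]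
  · have h3 := hdvd _ a3
    rw [map_sub, sub_eq_zero] at h3
    rw [← h3, map_mul, map_mul, map_sub, map_mul, map_one, hX, aeval_C, Algebra.smul_def]
  · rw [← map_mul, hdvd _ a4]
  · rw [← map_mul, mul_comm, hdvd _ a4]
  · rw [← e5, map_mul, hX]
  · rw [← e5, mul_comm, map_mul, hX]
  · rw [← map_mul, hdvd _ a6]
  · rw [← map_mul, mul_comm, hdvd _ a6]
  · intro z hz
    exact ⟨(aeval_comm hz f).eq, (aeval_comm hz g).eq, (aeval_comm hz k).eq, (aeval_comm hz d).eq⟩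

theorem good_final [FiniteDimensional F A] (h2 : (2 : F) ≠ 0) (hσ : IsInvo σ)
    (hInv : ∀ g : A, g * g = g → Inv σ g) (a : F) {y z : A} (hy : σ y = y) (hz : σ z = -z)
    (hzy : z * y = -(y * z)) (h1 : z * z + a • (y * y) = 1) :
    ∃ s : A, σ s = s ∧ s * s = algebraMap F A a := by
  set w := y * y with hw
  have hsw : σ w = w := by rw [hw, hσ.mul, hy]
  have hyw : Commute y w := by rw [hw]; exact (Commute.refl y).mul_right (Commute.refl y)
  have hzw : Commute z w := by
    change z * (y * y) = y * y * z
    rw [← mul_assoc, hzy, neg_mul, mul_assoc, hzy, mul_neg, neg_neg, mul_assoc]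
  obtain ⟨f, g, k, d, hfg1, hfg, hgf, hk, hkf, hfk, hdw, hwd, hdg, hgd, hsf, hsg, hsk, hsd, hcom⟩ :=
    fitting_elts h2 hσ a hsw
  obtain ⟨hzf, hzg, hzk, hdz⟩ := hcom z hzw
  obtain ⟨hyf, hyg, hyk, hdy⟩ := hcom y hyw
  have hgg : g * g = g := by
    have : (f + g) * g = g := by rw [hfg1, one_mul]
    rwa [add_mul, hfg, zero_add] at this
  have hff : f * f = f := by
    have : (f + g) * f = f := by rw [hfg1, one_mul]
    rwa [add_mul, hgf, add_zero] at this
  have hkg : k * g = k := by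
    have : k * (f + g) = k := by rw [hfg1, mul_one]
    rwa [mul_add, hkf, zero_add] at this
  have hgk : g * k = k := by
    have : (f + g) * k = k := by rw [hfg1, one_mul]
    rwa [add_mul, hfk, zero_add] at this
  have hdf : d * f = d := by
    have : d * (f + g) = d := by rw [hfg1, mul_one]
    rwa [mul_add, hdg, add_zero] at this
  have hfd : f * d = d := by
    have : (f + g) * d = d := by rw [hfg1, one_mul]
    rwa [add_mul, hgd, add_zero] at this
  -- hyperbolic part
  have hz0 : (z * k) * (z * k) = g := by
    rw [← hk, ← h1, add_sub_cancel_right, mul_assoc, ← mul_assoc k, ← hzk]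
    simp only [mul_assoc]
  have hz0g : (z * k) * g = z * k := by rw [mul_assoc, hkg]
  have hgz0 : g * (z * k) = z * k := by rw [← mul_assoc, ← hzg, mul_assoc, hgk]
  have hsz0 : σ (z * k) = -(z * k) := by rw [hσ.mul, hz, hsk, mul_neg, hzk]
  set z0 := z * k
  let t : F := 2⁻¹
  have ht : t + t = 1 := by simp only [t]; field_simp; norm_num
  have ht2 : t * t + t * t = t := by linear_combination t * ht
  let e := t • (g + z0)
  have hse : σ e = t • (g - z0) := by
    simp only [e, map_smul, map_add, hsg, hsz0, sub_eq_add_neg]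
  have hee : e * e = e := by
    simp only [e, smul_mul_smul_comm, mul_add, add_mul, hgg, hz0, hz0g, hgz0]
    rw [← ht2, add_smul]
    simp only [smul_add]; rw [ht2]; abel
  have hes : e + σ e = g := by
    rw [hse, ← smul_add, add_add_sub_cancel, ← two_smul F g, smul_smul]
    simp [t, h2]
  have ho1 : e * σ e = 0 := by
    rw [hse]; simp only [e, smul_mul_smul_comm, mul_sub, add_mul, hgg, hz0, hz0g, hgz0]
    simp [add_comm]
  have ho2 : σ e * e = 0 := by
    rw [hse]; simp only [e, smul_mul_smul_comm, mul_add, sub_mul, hgg, hz0, hz0g, hgz0]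
    simp
  obtain ⟨s0, b1, b2, b3, b4⟩ := (hInv e hee).sqrt hσ ho1 ho2 a
  rw [hes] at b2 b3 b4
  -- invertible part
  let v := y * d
  have hvz : z * v = -(v * z) := by
    simp only [v]; rw [← mul_assoc, hzy, neg_mul, mul_assoc, hdz, mul_assoc]
  have hvf : v * f = v := by simp only [v]; rw [mul_assoc, hdf]
  have hfv : f * v = v := by
    simp only [v]; rw [← mul_assoc, ← hyf, mul_assoc, hfd]
  have hsv : σ v = v := by simp only [v]; rw [hσ.mul, hy, hsd, hdy]
  have hvw : v * v * w = f := by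
    have h5 : v * v * w = d * w * (d * w) := by
      have hdw' : w * d = d * w := by rw [hwd, hdw]
      calc v * v * w = y * (d * y) * d * w := by simp only [v, mul_assoc]
        _ = w * d * (d * w) := by rw [← hdy, hw]; simp only [mul_assoc]
        _ = _ := by rw [hdw']
    rw [h5, hdw, hff]
  let s1 := v * (1 + z)
  have c1 : σ s1 = s1 := by
    simp only [s1]; rw [hσ.mul, hsv, map_add, hσ.one, hz, add_mul, neg_mul, hvz, neg_neg, mul_add,
      one_mul, mul_one]
  have c2 : s1 * s1 = a • f := by
    have h5 : (1 + z) * v = v * (1 - z) := by rw [add_mul, hvz, mul_sub]; simp [sub_eq_add_neg]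
    have h6 : (1 - z) * (1 + z) = a • w := by
      rw [← sub_eq_iff_eq_add'.2 h1.symm]; noncomm_ring
    calc s1 * s1 = v * ((1 + z) * v) * (1 + z) := by simp only [s1, mul_assoc]
      _ = v * v * ((1 - z) * (1 + z)) := by rw [h5]; simp only [mul_assoc]
      _ = _ := by rw [h6, mul_smul_comm, hvw]
  have c3 : s1 * f = s1 := by
    simp only [s1]; rw [mul_assoc, add_mul, hzf, one_mul, mul_add, ← mul_assoc, hvf, mul_add,
      mul_one]
  have c4 : f * s1 = s1 := by simp only [s1]; rw [← mul_assoc, hfv]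
  refine ⟨s1 + s0, by rw [map_add, c1, b1], ?_⟩
  rw [mul_add, add_mul, add_mul, mz c3 b4 hfg, mz b3 c4 hgf, c2, b2, zero_add, add_zero,
    ← smul_add, hfg1, Algebra.algebraMap_eq_smul_one]

end good

end HypSq

open HypSq in
theorem HypSq.tensor_decomp
    (F A K : Type*) [Field F] [Ring A] [Algebra F A]
    (σ : A →ₗ[F] A) (h1 : σ 1 = 1)
    [Field K] [Algebra F K]
    (a : F) (hns : ¬ ∃ b : F, b * b = a)
    (u : K) (hu : u * u = algebraMap F K a) (hgen : Algebra.adjoin F {u} = ⊤)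
    (ι : K ≃ₐ[F] K) (hι : ι u = -u)
    (hhyp : ∃ e : A ⊗[F] K, e * e = e ∧ TensorProduct.map σ ι.toLinearMap e = 1 - e) :
    ∃ x y : A, σ x = 1 - x ∧ σ y = y ∧ x * x + a • (y * y) = x ∧ x * y + y * x = y := by
  have hspan : ∀ k : K, ∃ r s : F, k = algebraMap F K r + s • u := by
    intro k
    have hk : k ∈ Algebra.adjoin F {u} := by rw [hgen]; trivial
    induction hk using Algebra.adjoin_induction with
    | mem x hx => exact ⟨0, 1, by simpa using hx⟩
    | algebraMap r => exact ⟨r, 0, by simp⟩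
    | add x y _ _ hx hy =>
      obtain ⟨r, s, rfl⟩ := hx
      obtain ⟨r', s', rfl⟩ := hy
      exact ⟨r + r', s + s', by rw [map_add, add_smul]; ring⟩
    | mul x y _ _ hx hy =>
      obtain ⟨r, s, rfl⟩ := hx
      obtain ⟨r', s', rfl⟩ := hy
      refine ⟨r * r' + s * s' * a, r * s' + s * r', ?_⟩
      simp only [Algebra.smul_def, map_add, map_mul]
      linear_combination (algebraMap F K s * algebraMap F K s') * hu
  have hli : LinearIndependent F ![(1 : K), u] := by
    rw [LinearIndependent.pair_iff]
    intro r s hrs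
    by_cases hs : s = 0
    · subst hs
      refine ⟨?_, rfl⟩
      simpa using hrs
    · exfalso
      apply hns
      refine ⟨-(s⁻¹ * r), ?_⟩
      have hu' : u = algebraMap F K (-(s⁻¹ * r)) := by
        have hs' : algebraMap F K s ≠ 0 := by simpa using hs
        rw [Algebra.smul_def, Algebra.smul_def] at hrs
        rw [map_neg, map_mul, map_inv₀]
        field_simp
        linear_combination hrs
      rw [hu', ← map_mul] at hu
      exact (algebraMap F K).injective hu
  have hsp : ⊤ ≤ Submodule.span F (Set.range ![(1 : K), u]) := by
    intro k _
    obtain ⟨r, s, rfl⟩ := hspan k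
    rw [Matrix.range_cons, Matrix.range_cons, Matrix.range_empty, Set.union_empty,
      Set.singleton_union, Submodule.mem_span_pair]
    exact ⟨r, s, by rw [Algebra.algebraMap_eq_smul_one]⟩
  let b := Module.Basis.mk hli hsp
  have hb0 : b 0 = 1 := by simp [b]
  have hb1 : b 1 = u := by simp [b]
  let co : Fin 2 → (A ⊗[F] K →ₗ[F] A) := fun i =>
    (TensorProduct.rid F A).toLinearMap ∘ₗ (LinearMap.lTensor A (b.coord i))
  have c00 : ∀ x : A, co 0 (x ⊗ₜ 1) = x := by
    intro x; simp [co, ← hb0]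
  have c01 : ∀ x : A, co 0 (x ⊗ₜ u) = 0 := by
    intro x; simp [co, ← hb1]
  have c10 : ∀ x : A, co 1 (x ⊗ₜ 1) = 0 := by
    intro x; simp [co, ← hb0]
  have c11 : ∀ x : A, co 1 (x ⊗ₜ u) = x := by
    intro x; simp [co, ← hb1]
  have huniq : ∀ x y x' y' : A, x ⊗ₜ[F] (1 : K) + y ⊗ₜ[F] u = x' ⊗ₜ[F] (1 : K) + y' ⊗ₜ[F] u →
      x = x' ∧ y = y' := by
    intro x y x' y' h
    have e0 := congrArg (co 0) h
    have e1 := congrArg (co 1) h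
    rw [map_add, map_add, c00, c00, c01, c01, add_zero, add_zero] at e0
    rw [map_add, map_add, c10, c10, c11, c11, zero_add, zero_add] at e1
    exact ⟨e0, e1⟩
  have hex : ∀ t : A ⊗[F] K, ∃ x y : A, t = x ⊗ₜ[F] (1 : K) + y ⊗ₜ[F] u := by
    intro t
    induction t using TensorProduct.induction_on with
    | zero => exact ⟨0, 0, by simp⟩
    | tmul x k =>
      obtain ⟨r, s, rfl⟩ := hspan k
      refine ⟨r • x, s • x, ?_⟩
      rw [TensorProduct.tmul_add, Algebra.algebraMap_eq_smul_one, TensorProduct.tmul_smul,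
        TensorProduct.tmul_smul, TensorProduct.smul_tmul', TensorProduct.smul_tmul']
    | add t t' h h' =>
      obtain ⟨x, y, rfl⟩ := h
      obtain ⟨x', y', rfl⟩ := h'
      exact ⟨x + x', y + y', by rw [TensorProduct.add_tmul, TensorProduct.add_tmul]; abel⟩
  obtain ⟨e, he, hτ⟩ := hhyp
  obtain ⟨x, y, rfl⟩ := hex e
  refine ⟨x, y, ?_⟩
  have e1 : (x ⊗ₜ[F] (1 : K) + y ⊗ₜ[F] u) * (x ⊗ₜ[F] (1 : K) + y ⊗ₜ[F] u) =
      (x * x + a • (y * y)) ⊗ₜ[F] (1 : K) + (x * y + y * x) ⊗ₜ[F] u := by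
    simp only [mul_add, add_mul, Algebra.TensorProduct.tmul_mul_tmul, mul_one, one_mul, hu,
      Algebra.algebraMap_eq_smul_one, TensorProduct.tmul_smul, TensorProduct.add_tmul,
      TensorProduct.smul_tmul']
    abel
  rw [e1] at he
  obtain ⟨k1, k2⟩ := huniq _ _ _ _ he
  have e2 : (σ x) ⊗ₜ[F] (1 : K) + (-σ y) ⊗ₜ[F] u = (1 - x) ⊗ₜ[F] (1 : K) + (-y) ⊗ₜ[F] u := by
    have h3 : TensorProduct.map σ ι.toLinearMap (x ⊗ₜ[F] (1 : K) + y ⊗ₜ[F] u) =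
        (σ x) ⊗ₜ[F] (1 : K) + (-σ y) ⊗ₜ[F] u := by
      simp [hι, TensorProduct.tmul_neg, TensorProduct.neg_tmul]
    rw [← h3, hτ, TensorProduct.sub_tmul, TensorProduct.neg_tmul,
      Algebra.TensorProduct.one_def]
    abel
  obtain ⟨k3, k4⟩ := huniq _ _ _ _ e2
  exact ⟨k3, neg_injective k4, k1, k2⟩

open HypSq in
theorem exists_symmetric_square_root_of_unitary_extension_hyperbolic
    (F A K : Type*) [Field F] [Ring A] [Algebra F A]
    (h2 : (2 : F) ≠ 0)
    [Algebra.IsCentral F A] [IsSimpleRing A] [FiniteDimensional F A]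
    (m : ℕ) (hdeg : Module.finrank F A = m ^ 2)
    (σ : A →ₗ[F] A) (hσmul : ∀ x y : A, σ (x * y) = σ y * σ x)
    (hσinv : ∀ x : A, σ (σ x) = x)
    [Field K] [Algebra F K]
    (a : F) (ha : a ≠ 0) (hns : ¬ ∃ b : F, b * b = a)
    (u : K) (hu : u * u = algebraMap F K a) (hgen : Algebra.adjoin F {u} = ⊤)
    (ι : K ≃ₐ[F] K) (hι : ι u = -u)
    (hhyp : ∃ e : A ⊗[F] K, e * e = e ∧ TensorProduct.map σ ι.toLinearMap e = 1 - e)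
    (hexc : ¬ (Nonempty (A ≃ₐ[F] Matrix (Fin m) (Fin m) F) ∧ m % 4 = 2 ∧
        Module.finrank F (LinearMap.ker (σ - LinearMap.id)) = m * (m - 1) / 2)) :
    ∃ s : A, σ s = s ∧ s * s = algebraMap F A a := by
  have hσ : IsInvo σ := ⟨hσmul, hσinv⟩
  haveI : IsArtinianRing A := IsArtinianRing.of_finite F A
  haveI : IsSemisimpleRing A := IsSimpleRing.isSemisimpleRing_iff_isArtinianRing.2 inferInstance
  by_cases hgood : ∀ e : A, Prim e → ∃ x, x * e = x ∧ σ e * x = x ∧ σ x = x ∧ x ≠ 0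
  · obtain ⟨x, y, k1, k2, k3, k4⟩ :=
      HypSq.tensor_decomp F A K σ hσ.one a hns u hu hgen ι hι hhyp
    refine good_final h2 hσ (inv_all hσ hgood) a (y := y + y) (z := x + x - 1)
      (by rw [map_add, k2]) (by rw [map_sub, map_add, k1, hσ.one]; abel) ?_ ?_
    · have : (x + x - 1) * (y + y) + (y + y) * (x + x - 1) =
          4 • (x * y + y * x - y) := by noncomm_ring
      rw [k4, sub_self, smul_zero] at this
      exact eq_neg_of_add_eq_zero_left this
    · have : (x + x - 1) * (x + x - 1) + a • ((y + y) * (y + y)) =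
          4 • (x * x + a • (y * y) - x) + 1 := by
        have h5 : a • ((y + y) * (y + y)) = 4 • (a • (y * y)) := by
          simp only [mul_add, add_mul, smul_add]; abel
        rw [h5]; noncomm_ring
      rw [this, k3, sub_self, smul_zero, zero_add]
  · push Not at hgood
    obtain ⟨e0, he0, hb0⟩ := hgood
    have hb : Bad σ e0 := by
      intro x hx1 hx2
      have h3 : σ x * e0 = σ x := by nth_rewrite 1 [← hσ.inv e0]; rw [← hσ.mul, hx2]
      have h4 : σ e0 * σ x = σ x := by rw [← hσ.mul, hx1]
      have := hb0 (x + σ x) (by rw [add_mul, hx1, h3]) (by rw [mul_add, hx2, h4])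
        (by rw [map_add, hσ.inv, add_comm])
      exact eq_neg_of_add_eq_zero_right this
    obtain ⟨e, k, hk, g1, g2, g3⟩ := bad_decomp h2 hσ (fun e he => hb.transfer hσ he0 he) 1
      (one_mul 1) hσ.one
    have hrk : Rk (1 : A) (k + k) := by
      rw [← g1]; exact hk.add (hσ.rk hk) g2 g3
    obtain ⟨b1, b2, b3⟩ := bad_final h2 hσ he0 hb hrk
    have hm : m = k + k := by
      rw [hdeg] at b2
      exact Nat.pow_left_injective (n := 2) (by norm_num) b2
    subst hm
    rcases Nat.even_or_odd k with ⟨j, hj⟩ | ⟨j, hj⟩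
    · have hk' : Rk e (2 * j) := by rw [two_mul, ← hj]; exact hk
      obtain ⟨s, s1, s2, -, -⟩ := (Rk.inv_even hσ j e hk').sqrt hσ g2 g3 a
      exact ⟨s, s1, by rw [s2, g1, Algebra.algebraMap_eq_smul_one]⟩
    · exact absurd ⟨b1, by omega, b3⟩ hexc
end

section
/- Let k be a field of characteristic 0, A a central simple k-algebra, and σ an involution of the first kind on A. Let B̂ = A((ξ)) be the ring of formal Laurent series over A with the unitary involution τ̂(∑ a_i ξ^i) = ∑ (−1)^i σ(a_i) ξ^i. Then (A,σ) is hyperbolic if and only if (B̂,τ̂) is hyperbolic; that is, there exists an idempotent e ∈ A with σ(e) = 1 − e if and only if there exists an idempotent ê ∈ B̂ with τ̂(ê) = 1 − ê. -/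
noncomputable section

/-- The involution `τ̂(∑ aᵢ ξ^i) = ∑ (−1)^i σ(aᵢ) ξ^i` on the Laurent series ring
`B̂ = A((ξ))`, for `σ` a linear map on `A`. -/
def tauHat {k A : Type*} [Field k] [Ring A] [Algebra k A] (σ : A →ₗ[k] A)
    (y : LaurentSeries A) : LaurentSeries A where
  coeff i := ((-1 : k) ^ i) • σ (y.coeff i)
  isPWO_support' := y.isPWO_support.mono (by
    intro i hi
    simp only [Function.mem_support, ne_eq] at hi ⊢
    intro h
    exact hi (by rw [h, map_zero, smul_zero]))

open HahnSeries in
theorem tauHat_mul {k A : Type*} [Field k] [Ring A] [Algebra k A] (σ : A →ₗ[k] A)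
    (hσmul : ∀ x y : A, σ (x * y) = σ y * σ x) (x y : LaurentSeries A) :
    tauHat σ (x * y) = tauHat σ y * tauHat σ x := by
  have hs : ∀ z : LaurentSeries A, (tauHat σ z).support ⊆ z.support := by
    intro z i hi h
    apply hi
    change ((-1 : k) ^ i) • σ (z.coeff i) = 0
    have h' : z.coeff i = 0 := h
    rw [h', map_zero, smul_zero]
  have h0 : ∀ z : LaurentSeries A, ∀ i, (tauHat σ z).coeff i = ((-1 : k) ^ i) • σ (z.coeff i) :=
    fun _ _ => rfl
  ext a
  have key : (tauHat σ y * tauHat σ x).coeff a =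
      ∑ ij ∈ Finset.antidiagonal y.isPWO_support x.isPWO_support a,
        (tauHat σ y).coeff ij.1 * (tauHat σ x).coeff ij.2 := by
    rw [coeff_mul_left' y.isPWO_support (hs y)]
    apply Finset.sum_subset
    · intro ij hij
      simp only [Finset.mem_antidiagonal] at hij ⊢
      exact ⟨hij.1, hs x hij.2.1, hij.2.2⟩
    · intro ij hij hn
      have : (tauHat σ x).coeff ij.2 = 0 := by
        by_contra hne
        apply hn
        simp only [Finset.mem_antidiagonal] at hij ⊢
        exact ⟨hij.1, hne, hij.2.2⟩
      rw [this, mul_zero]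
  rw [key, h0, coeff_mul, map_sum, Finset.smul_sum]
  refine Finset.sum_nbij' Prod.swap Prod.swap ?_ ?_ ?_ ?_ ?_
  · intro ij hij
    simp only [Finset.mem_antidiagonal, Prod.fst_swap, Prod.snd_swap] at hij ⊢
    exact ⟨hij.2.1, hij.1, by rw [add_comm]; exact hij.2.2⟩
  · intro ij hij
    simp only [Finset.mem_antidiagonal, Prod.fst_swap, Prod.snd_swap] at hij ⊢
    exact ⟨hij.2.1, hij.1, by rw [add_comm]; exact hij.2.2⟩
  · intro ij _; simp
  · intro ij _; simp
  · intro ij hij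
    simp only [Finset.mem_antidiagonal] at hij
    rw [h0, h0, hσmul, smul_mul_smul_comm, ← hij.2.2, Prod.fst_swap, Prod.snd_swap, add_comm,
      zpow_add₀ (by simp)]

theorem tauHat_zero' {k A : Type*} [Field k] [Ring A] [Algebra k A] (σ : A →ₗ[k] A) :
    tauHat σ 0 = 0 := by
  ext i
  change ((-1 : k) ^ i) • σ 0 = 0
  simp

theorem tauHat_ofPS {k A : Type*} [Field k] [Ring A] [Algebra k A] (σ : A →ₗ[k] A)
    (x : PowerSeries A) :
    ∃ y : PowerSeries A, tauHat σ (HahnSeries.ofPowerSeries ℤ A x) =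
      HahnSeries.ofPowerSeries ℤ A y ∧
      PowerSeries.constantCoeff y = σ (PowerSeries.constantCoeff x) := by
  refine ⟨PowerSeries.mk fun n => ((-1 : k) ^ n) • σ (PowerSeries.coeff n x), ?_, ?_⟩
  · ext i
    change ((-1 : k) ^ i) • σ ((HahnSeries.ofPowerSeries ℤ A x).coeff i) = _
    rw [PowerSeries.coeff_coe, PowerSeries.coeff_coe]
    split_ifs with h
    · simp
    · obtain ⟨n, rfl⟩ := Int.eq_ofNat_of_zero_le (not_lt.mp h)
      simp
  · rw [← PowerSeries.coeff_zero_eq_constantCoeff_apply, PowerSeries.coeff_mk]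
    simp

/-- The left ideal of constant terms of power series in `B̂ ê`. -/
def leadIdeal {A : Type*} [Ring A] (ê : LaurentSeries A) : Ideal A where
  carrier := {a | ∃ x : PowerSeries A, HahnSeries.ofPowerSeries ℤ A x * ê =
    HahnSeries.ofPowerSeries ℤ A x ∧ PowerSeries.constantCoeff x = a}
  add_mem' := by
    rintro a b ⟨x, hx, rfl⟩ ⟨y, hy, rfl⟩
    exact ⟨x + y, by rw [map_add, add_mul, hx, hy], by simp⟩
  zero_mem' := ⟨0, by simp, by simp⟩
  smul_mem' := by
    rintro c a ⟨x, hx, rfl⟩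
    exact ⟨PowerSeries.C c * x, by rw [map_mul, mul_assoc, hx], by simp⟩

theorem lead_mem {A : Type*} [Ring A] (ê v : LaurentSeries A) (hv : v * ê = v) :
    PowerSeries.constantCoeff v.powerSeriesPart ∈ leadIdeal ê :=
  ⟨v.powerSeriesPart, by
    rw [LaurentSeries.ofPowerSeries_powerSeriesPart, mul_assoc, hv], rfl⟩

/-- The descent direction. -/
theorem descent {k A : Type*} [Field k] [CharZero k] [Ring A] [Algebra k A] [IsSemisimpleRing A]
    (σ : A →ₗ[k] A) (hσmul : ∀ x y : A, σ (x * y) = σ y * σ x)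
    (hσinv : ∀ x : A, σ (σ x) = x) (hσone : σ 1 = 1)
    (ê : LaurentSeries A) (hê : ê * ê = ê) (hτ : tauHat σ ê = 1 - ê) :
    ∃ e : A, e * e = e ∧ σ e = 1 - e := by
  obtain ⟨f, hf, hJ⟩ := IsSemisimpleRing.ideal_eq_span_idempotent (leadIdeal ê)
  have hff : f * f = f := hf
  have hmem : ∀ a ∈ leadIdeal ê, a * f = a := by
    intro a ha
    rw [hJ, Ideal.mem_span_singleton'] at ha
    obtain ⟨b, rfl⟩ := ha
    rw [mul_assoc, hff]
  have hfJ : f ∈ leadIdeal ê := by rw [hJ]; exact Ideal.mem_span_singleton_self f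
  -- isotropy
  have hfσ : f * σ f = 0 := by
    obtain ⟨x, hx, hxf⟩ := hfJ
    obtain ⟨y, hy, hyf⟩ := tauHat_ofPS σ x
    have h1 : HahnSeries.ofPowerSeries ℤ A (x * y) = 0 := by
      rw [map_mul, ← hy, ← hx, tauHat_mul σ hσmul, hτ]
      rw [mul_assoc, ← mul_assoc ê, mul_sub, mul_one, hê, sub_self, zero_mul, mul_zero]
    have h2 : x * y = 0 := HahnSeries.ofPowerSeries_injective (by rw [h1, map_zero])
    have h3 := congrArg PowerSeries.constantCoeff h2
    rwa [map_mul, hyf, hxf, map_zero] at h3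
  -- adjust
  set c : k := 1 / 2 with hc
  have hcc : c + c = 1 := by rw [hc]; norm_num
  set g : A := σ f * f with hg
  have hgs : σ g = g := by rw [hg, hσmul, hσinv]
  have hσff : σ f * σ f = σ f := by rw [← hσmul, hff]
  have hfg : f * g = 0 := by rw [hg, ← mul_assoc, hfσ, zero_mul]
  have hgσ : g * σ f = 0 := by rw [hg, mul_assoc, hfσ, mul_zero]
  have hgf : g * f = g := by rw [hg, mul_assoc, hff]
  have hσg : σ f * g = g := by rw [hg, ← mul_assoc, hσff]
  have hgg : g * g = 0 := by nth_rw 2 [hg]; rw [← mul_assoc, hgσ, zero_mul]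
  obtain ⟨e, he⟩ : ∃ e, e = f - c • g := ⟨_, rfl⟩
  have hσe : σ e = σ f - c • g := by rw [he, map_sub, map_smul, hgs]
  have hef : e * f = e := by rw [he, sub_mul, hff, smul_mul_assoc, hgf]
  have hfe : f * e = f := by rw [he, mul_sub, hff, mul_smul_comm, hfg, smul_zero, sub_zero]
  have hee : e * e = e := by
    nth_rw 1 [← hef]; rw [mul_assoc, hfe, hef]
  have heσe : e * σ e = 0 := by
    rw [hσe, he]
    simp only [mul_sub, sub_mul, smul_mul_assoc, mul_smul_comm, hfσ, hfg, hgσ, hgg, smul_zero,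
      sub_zero]
  have hσee : σ e * e = 0 := by
    rw [hσe, he]
    simp only [mul_sub, sub_mul, smul_mul_assoc, mul_smul_comm, hσg, hgf, hgg, smul_zero,
      sub_zero]
    rw [← hg, sub_sub, ← add_smul, hcc, one_smul, sub_self]
  have hmem' : ∀ a ∈ leadIdeal ê, a * e = a := by
    intro a ha
    have := hmem a ha
    rw [← this, mul_assoc, hfe]
  have heJ : e ∈ leadIdeal ê := by
    rw [hJ, Ideal.mem_span_singleton']; exact ⟨e, hef⟩
  refine ⟨e, hee, ?_⟩
  obtain ⟨x, hx, hxe⟩ := heJ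
  obtain ⟨u, hu⟩ : ∃ u : PowerSeries A, u = PowerSeries.C e * x + PowerSeries.C (1 - e) :=
    ⟨_, rfl⟩
  have hu0 : PowerSeries.constantCoeff u = ((1 : Aˣ) : A) := by
    rw [hu]; simp [hxe, hee]
  obtain ⟨w, hw⟩ : ∃ w, w = PowerSeries.invOfUnit u 1 := ⟨_, rfl⟩
  have huw : u * w = 1 := by rw [hw]; exact PowerSeries.mul_invOfUnit u 1 hu0
  have hwu : w * u = 1 := by rw [hw]; exact PowerSeries.invOfUnit_mul u 1 hu0
  have hw0 : PowerSeries.constantCoeff w = 1 := by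
    rw [hw, PowerSeries.constantCoeff_invOfUnit]; simp
  let P := HahnSeries.ofPowerSeries ℤ A
  have hPuw : P u * P w = 1 := by rw [← map_mul, huw, map_one]
  have hPwu : P w * P u = 1 := by rw [← map_mul, hwu, map_one]
  have hCe : PowerSeries.C e * PowerSeries.C e = PowerSeries.C e := by rw [← map_mul, hee]
  have hCeu : PowerSeries.C e * u = PowerSeries.C e * x := by
    rw [hu, mul_add, ← mul_assoc, hCe, ← map_mul, mul_sub, hee, mul_one, sub_self, map_zero,
      add_zero]
  have hz : ê * P w * P (PowerSeries.C (1 - e)) = 0 := by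
    by_contra hne
    obtain ⟨v, hv⟩ : ∃ v, v = ê * P w * P (PowerSeries.C (1 - e)) * P u := ⟨_, rfl⟩
    have hvw : v * P w = ê * P w * P (PowerSeries.C (1 - e)) := by
      rw [hv, mul_assoc, hPuw, mul_one]
    have hvne : v ≠ 0 := by
      intro h; apply hne; rw [← hvw, h, zero_mul]
    have hvê : v * ê = v := by
      have : v = ê - ê * P w * P (PowerSeries.C e * x) := by
        rw [hv, ← hCeu, map_sub, map_one, map_sub, map_one, map_mul, mul_sub, mul_one, sub_mul,
          mul_assoc ê (P w) (P u), hPwu, mul_one, mul_assoc _ _ (P u)]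
      have hx' : P x * ê = P x := hx
      rw [this, sub_mul, hê, map_mul]
      simp only [mul_assoc, hx']
    have hve : v * P w * P (PowerSeries.C e) = 0 := by
      rw [hvw, mul_assoc, ← map_mul, ← map_mul, sub_mul, one_mul, hee, sub_self, map_zero,
        map_zero, mul_zero]
    have h1 := hmem' _ (lead_mem ê v hvê)
    have h2 : P (v.powerSeriesPart * w * PowerSeries.C e) = 0 := by
      rw [map_mul, map_mul]
      change HahnSeries.ofPowerSeries ℤ A _ * _ * _ = 0
      rw [LaurentSeries.ofPowerSeries_powerSeriesPart, mul_assoc, mul_assoc, ← mul_assoc v, hve,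
        mul_zero]
    have h3 : v.powerSeriesPart * w * PowerSeries.C e = 0 :=
      HahnSeries.ofPowerSeries_injective (h2.trans (map_zero P).symm)
    have h4 := congrArg PowerSeries.constantCoeff h3
    rw [map_mul, map_mul, hw0, mul_one, PowerSeries.constantCoeff_C, h1, map_zero,
      ← PowerSeries.coeff_zero_eq_constantCoeff_apply, LaurentSeries.powerSeriesPart_coeff] at h4
    simp only [Nat.cast_zero, add_zero] at h4
    exact hvne (HahnSeries.coeff_order_eq_zero.mp h4)
  obtain ⟨p, hp⟩ : ∃ p, p = 1 - e - σ e := ⟨_, rfl⟩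
  have hσp : σ p = p := by
    rw [hp, map_sub, map_sub, hσone, hσinv, sub_right_comm]
  have hep : e * p = 0 := by
    rw [hp, mul_sub, mul_sub, mul_one, hee, heσe, sub_self, sub_zero]
  have hpe : p * e = 0 := by
    rw [hp, sub_mul, sub_mul, one_mul, hee, hσee, sub_self, sub_zero]
  have hêq : ê * P (w * PowerSeries.C p) = 0 := by
    have h1 : p = (1 - e) * p := by rw [sub_mul, one_mul, hep, sub_zero]
    rw [h1, map_mul, ← mul_assoc, map_mul, map_mul, ← mul_assoc, hz, zero_mul]
  obtain ⟨y, hy, hy0⟩ := tauHat_ofPS σ (w * PowerSeries.C p)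
  have hpJ : p ∈ leadIdeal ê := by
    refine ⟨y, ?_, ?_⟩
    · have h := congrArg (tauHat σ) hêq
      rw [tauHat_mul σ hσmul, tauHat_zero', hτ, hy, mul_sub, mul_one, sub_eq_zero] at h
      exact h.symm
    · rw [hy0, map_mul, hw0, one_mul, PowerSeries.constantCoeff_C, hσp]
  have hp0 : p = 0 := by rw [← hmem' p hpJ, hpe]
  rw [hp, sub_eq_zero] at hp0
  exact hp0.symm

/-- Let `k` be a field of characteristic 0, `A` a central simple
`k`-algebra and `σ` an involution of the first kind on `A`.  Let `B̂ = A((ξ))` with the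
unitary involution `τ̂(∑ aᵢ ξ^i) = ∑ (−1)^i σ(aᵢ) ξ^i`.  Then `(A, σ)` is hyperbolic if
and only if `(B̂, τ̂)` is hyperbolic. -/
theorem hyperbolic_iff_laurent_hyperbolic
    (k A : Type*) [Field k] [CharZero k] [Ring A] [Algebra k A]
    [Algebra.IsCentral k A] [IsSimpleRing A] [FiniteDimensional k A]
    (σ : A →ₗ[k] A) (hσmul : ∀ x y : A, σ (x * y) = σ y * σ x)
    (hσinv : ∀ x : A, σ (σ x) = x) :
    (∃ e : A, e * e = e ∧ σ e = 1 - e) ↔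
      (∃ ehat : LaurentSeries A, ehat * ehat = ehat ∧ tauHat σ ehat = 1 - ehat) := by
  have hσone : σ 1 = 1 := by
    have h := hσmul (σ 1) 1
    rw [mul_one, hσinv, mul_one] at h
    exact h.symm
  constructor
  · rintro ⟨e, he, hσ⟩
    refine ⟨HahnSeries.C e, by rw [← map_mul, he], ?_⟩
    rw [← map_one HahnSeries.C, ← map_sub, ← hσ]
    ext i
    change ((-1 : k) ^ i) • σ ((HahnSeries.C e).coeff i) = _
    rw [HahnSeries.C_apply, HahnSeries.C_apply, HahnSeries.coeff_single, HahnSeries.coeff_single]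
    split_ifs with h
    · simp [h]
    · simp
  · rintro ⟨ê, hê, hτ⟩
    have : IsArtinianRing A := IsArtinianRing.of_finite k A
    exact descent σ hσmul hσinv hσone ê hê hτ

end
end

section
/- Let k be a field of characteristic 0, let ℓ be a quadratic field extension of k, let C be a central simple ℓ-algebra, and let ρ be a unitary involution on C fixing k (a k-linear ring anti-automorphism of C with ρ∘ρ = id whose restriction to ℓ is the nontrivial k-automorphism of ℓ). Let F̂ = k((x)) be the field of formal Laurent series over k, and let (C,ρ)_{F̂} = (C ⊗_k F̂, ρ ⊗ id). Then: (C,ρ) is isotropic if and only if (C,ρ)_{F̂} is isotropic, and (C,ρ) is hyperbolic if and only if (C,ρ)_{F̂} is hyperbolic. -/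
open scoped TensorProduct

attribute [local instance 10000] Algebra.toModule

namespace IsoHyp

/-- trace of left multiplication -/
noncomputable def TL (k C : Type*) [Field k] [Ring C] [Algebra k C] : C →ₗ[k] k :=
  (LinearMap.trace k C).comp (LinearMap.mul k C)

/-- trace of right multiplication -/
noncomputable def TR (k C : Type*) [Field k] [Ring C] [Algebra k C] : C →ₗ[k] k :=
  (LinearMap.trace k C).comp (LinearMap.mul k C).flip

section
variable {k C : Type*} [Field k] [Ring C] [Algebra k C]

lemma TL_apply (c : C) : TL k C c = LinearMap.trace k C (LinearMap.mulLeft k c) := rfl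
lemma TR_apply (c : C) : TR k C c = LinearMap.trace k C (LinearMap.mulRight k c) := rfl

lemma TL_comm (a b : C) : TL k C (a * b) = TL k C (b * a) := by
  simp only [TL_apply, LinearMap.mulLeft_mul]
  exact LinearMap.trace_mul_comm k _ _

lemma TR_comm (a b : C) : TR k C (a * b) = TR k C (b * a) := by
  simp only [TR_apply, LinearMap.mulRight_mul]
  exact LinearMap.trace_mul_comm k _ _

lemma TR_idem [FiniteDimensional k C] {e : C} (he : e * e = e) :
    TR k C e = (Module.finrank k (LinearMap.range (LinearMap.mulRight k e)) : k) := by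
  rw [TR_apply]
  refine LinearMap.IsProj.trace (LinearMap.IsIdempotentElem.isProj_range _ ?_)
  ext x
  simp [mul_assoc, he]

lemma TL_eq_TR [CharZero k] [FiniteDimensional k C] [IsSimpleRing C] : TL k C = TR k C := by
  have hN : TL k C 1 ≠ 0 := by
    rw [TL_apply, LinearMap.mulLeft_one, LinearMap.trace_id]
    exact_mod_cast (Module.finrank_pos (R := k) (M := C)).ne'
  let B : C →ₗ[k] Module.Dual k C := (LinearMap.mul k C).compr₂ (TL k C)
  have hB : ∀ a b, B a b = TL k C (a * b) := fun _ _ => rfl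
  let I : TwoSidedIdeal C := TwoSidedIdeal.mk' {a | ∀ b, TL k C (a * b) = 0} (by simp)
    (by intro x y hx hy b; rw [add_mul, map_add, hx, hy, add_zero])
    (by intro x hx b; rw [neg_mul, map_neg, hx, neg_zero])
    (by intro x y hy b; rw [TL_comm, ← mul_assoc, TL_comm]; exact hy _)
    (by intro x y hx b; rw [mul_assoc]; exact hx _)
  have hI : ∀ a, a ∈ I ↔ ∀ b, TL k C (a * b) = 0 := fun a => by
    simp only [I, TwoSidedIdeal.mem_mk', Set.mem_ofPred_eq]
  have hinj : Function.Injective B := by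
    rw [injective_iff_map_eq_zero]
    intro a ha
    by_contra hne
    have h1 : (1 : C) ∈ I := IsSimpleRing.one_mem_of_ne_zero_mem I hne
      ((hI a).2 fun b => by rw [← hB, ha]; rfl)
    exact hN (by simpa using (hI 1).1 h1 1)
  have hsurj : Function.Surjective B :=
    (LinearMap.injective_iff_surjective_of_finrank_eq_finrank
      (Subspace.dual_finrank_eq (K := k) (V := C)).symm).1 hinj
  obtain ⟨z, hz⟩ := hsurj (TL k C - TR k C)
  have hz' : ∀ c, TL k C (z * c) = TL k C c - TR k C c := fun c => by
    rw [← hB, hz]; rfl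
  have hcent : ∀ c, c * z = z * c := by
    intro c
    apply hinj
    ext d
    rw [hB, hB, mul_assoc, TL_comm, mul_assoc, mul_assoc, hz', hz', TL_comm, TR_comm]
  by_cases hz0 : z = 0
  · rw [hz0, map_zero] at hz
    exact (sub_eq_zero.1 hz.symm)
  · exfalso
    have hzc : z ∈ Subring.center C := Subring.mem_center_iff.2 hcent
    obtain ⟨⟨w, hw⟩, hw'⟩ := (IsSimpleRing.isField_center C).mul_inv_cancel
      (a := ⟨z, hzc⟩) (by simpa [Subtype.ext_iff] using hz0)
    have h1 : z * w = 1 := congrArg Subtype.val hw'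
    have h2 := hz' w
    rw [h1] at h2
    apply hN
    rw [h2, TL_apply, TR_apply, sub_eq_zero]
    congr 1
    ext c
    simp [Subring.mem_center_iff.1 hw c]

lemma TR_inv (ρ : C →ₗ[k] C) (hρmul : ∀ x y : C, ρ (x * y) = ρ y * ρ x)
    (hρinv : ∀ x : C, ρ (ρ x) = x)
    [CharZero k] [FiniteDimensional k C] [IsSimpleRing C] (c : C) :
    TR k C (ρ c) = TR k C c := by
  conv_rhs => rw [← TL_eq_TR]
  let E : C ≃ₗ[k] C := LinearEquiv.ofInvolutive ρ hρinv
  rw [TL_apply, TR_apply, ← LinearMap.trace_conj' (LinearMap.mulLeft k c) E]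
  congr 1
  ext x
  have : E.symm x = ρ x := rfl
  have h2 : ∀ x, E x = ρ x := fun _ => rfl
  simp [LinearEquiv.conj_apply, this, h2, hρmul, hρinv]

end

section
variable (k F C : Type*) [Field k] [Field F] [Algebra k F] [Ring C] [Algebra k C]
  [FiniteDimensional k C]

lemma TR_tmul (a : F) (c : C) : TR F (F ⊗[k] C) (a ⊗ₜ c) = a * algebraMap k F (TR k C c) := by
  have : (a ⊗ₜ c : F ⊗[k] C) = a • (1 ⊗ₜ c) := by simp [TensorProduct.smul_tmul']
  rw [this, map_smul, smul_eq_mul]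
  congr 1
  rw [TR_apply, TR_apply, ← LinearMap.trace_baseChange]
  congr 1
  ext x
  simp

lemma TR_inv_baseChange [CharZero k] [IsSimpleRing C] (ρ : C →ₗ[k] C)
    (hρmul : ∀ x y : C, ρ (x * y) = ρ y * ρ x)
    (hρinv : ∀ x : C, ρ (ρ x) = x) (y : F ⊗[k] C) :
    TR F (F ⊗[k] C) (ρ.lTensor F y) = TR F (F ⊗[k] C) y := by
  induction y with
  | zero => simp
  | add x y hx hy => rw [map_add, map_add, hx, hy, map_add]
  | tmul a c => rw [LinearMap.lTensor_tmul, TR_tmul, TR_tmul, TR_inv ρ hρmul hρinv]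

end

section
variable {k F P C : Type*} [Field k] [Field F] [Algebra k F] [CommRing P] [Algebra k P]
  [Ring C] [Algebra k C]

lemma lTensor_anti (ρ : C →ₗ[k] C) (hρmul : ∀ x y : C, ρ (x * y) = ρ y * ρ x)
    (x y : P ⊗[k] C) : ρ.lTensor P (x * y) = ρ.lTensor P y * ρ.lTensor P x := by
  induction x with
  | zero => simp
  | add x x' hx hx' => rw [add_mul, map_add, hx, hx', map_add, mul_add]
  | tmul a c =>
    induction y with
    | zero => simp
    | add y y' hy hy' => rw [mul_add, map_add, hy, hy', map_add, add_mul]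
    | tmul b d => simp [hρmul, mul_comm a b]

/-- the inclusion of integral elements -/
noncomputable def J (C : Type*) [Ring C] [Algebra k C] (j : P →ₐ[k] F) :
    P ⊗[k] C →ₐ[k] F ⊗[k] C :=
  Algebra.TensorProduct.map j (AlgHom.id k C)

/-- the reduction map -/
noncomputable def Rd (C : Type*) [Ring C] [Algebra k C] (ev : P →ₐ[k] k) : P ⊗[k] C →ₐ[k] C :=
  (Algebra.TensorProduct.lid k C).toAlgHom.comp (Algebra.TensorProduct.map ev (AlgHom.id k C))

@[simp] lemma J_tmul (j : P →ₐ[k] F) (p : P) (c : C) : J C j (p ⊗ₜ c) = j p ⊗ₜ c := rfl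
@[simp] lemma Rd_tmul (ev : P →ₐ[k] k) (p : P) (c : C) : Rd C ev (p ⊗ₜ c) = ev p • c := rfl

lemma J_inj (j : P →ₐ[k] F) (hj : Function.Injective j) : Function.Injective (J C j) := by
  have : ((J C j : P ⊗[k] C →ₐ[k] F ⊗[k] C) : P ⊗[k] C → F ⊗[k] C) =
      LinearMap.rTensor C j.toLinearMap := by
    rfl
  rw [this]
  exact Module.Flat.rTensor_preserves_injective_linearMap _ hj

lemma J_lT (j : P →ₐ[k] F) (ρ : C →ₗ[k] C) (x : P ⊗[k] C) :
    J C j (ρ.lTensor P x) = ρ.lTensor F (J C j x) := by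
  induction x with
  | zero => simp
  | add x y hx hy => simp only [map_add, hx, hy]
  | tmul a c => simp

lemma Rd_lT (ev : P →ₐ[k] k) (ρ : C →ₗ[k] C) (x : P ⊗[k] C) :
    Rd C ev (ρ.lTensor P x) = ρ (Rd C ev x) := by
  induction x with
  | zero => simp
  | add x y hx hy => simp only [map_add, hx, hy]
  | tmul a c => simp

lemma lT_smul (ρ : C →ₗ[k] C) (u : F) (x : F ⊗[k] C) :
    ρ.lTensor F (u • x) = u • ρ.lTensor F x := 
  (ρ.baseChange F).map_smul u x

/-- the scaling property of the pair `P ⊆ F` -/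
def Scaling (j : P →ₐ[k] F) (ev : P →ₐ[k] k) : Prop :=
  ∀ (n : ℕ) (f : Fin n → F), f ≠ 0 → ∃ u : F, u ≠ 0 ∧ ∃ g : Fin n → P,
    (∀ i, j (g i) = u * f i) ∧ ∃ i, ev (g i) ≠ 0

lemma scale [FiniteDimensional k C] {j : P →ₐ[k] F} {ev : P →ₐ[k] k} (h : Scaling j ev)
    (y : F ⊗[k] C) (hy : y ≠ 0) :
    ∃ u : F, u ≠ 0 ∧ ∃ z : P ⊗[k] C, J C j z = u • y ∧ Rd C ev z ≠ 0 := by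
  let b := Module.finBasis k C
  let b' := b.baseChange F
  obtain ⟨u, hu, g, hg, i, hi⟩ := h _ (fun i => b'.repr y i) (by
    intro h0
    apply hy
    apply b'.ext_elem
    intro i
    simpa using congrFun h0 i)
  refine ⟨u, hu, ∑ i, g i ⊗ₜ b i, ?_, ?_⟩
  · conv_rhs => rw [← b'.sum_repr y]
    rw [map_sum, Finset.smul_sum]
    refine Finset.sum_congr rfl fun i _ => ?_
    simp [b', hg, TensorProduct.smul_tmul']
  · intro h0
    rw [map_sum] at h0
    simp only [Rd_tmul] at h0
    exact hi (Fintype.linearIndependent_iff.1 b.linearIndependent _ h0 i)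

theorem iso_descend [FiniteDimensional k C] (ρ : C →ₗ[k] C)
    (j : P →ₐ[k] F) (hj : Function.Injective j) (ev : P →ₐ[k] k) (h : Scaling j ev)
    (y : F ⊗[k] C) (hy : y ≠ 0) (hy2 : ρ.lTensor F y * y = 0) :
    ∃ c : C, c ≠ 0 ∧ ρ c * c = 0 := by
  obtain ⟨u, hu, z, hz, hz0⟩ := scale h y hy
  refine ⟨_, hz0, ?_⟩
  have : ρ.lTensor P z * z = 0 := by
    apply J_inj j hj
    rw [map_mul, J_lT, hz, lT_smul, smul_mul_smul_comm, hy2, smul_zero, map_zero]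
  rw [← Rd_lT, ← map_mul, this, map_zero]

theorem hyp_descend [CharZero k] [FiniteDimensional k C] [IsSimpleRing C] (ρ : C →ₗ[k] C)
    (hρmul : ∀ x y : C, ρ (x * y) = ρ y * ρ x)
    (hρinv : ∀ x : C, ρ (ρ x) = x)
    (j : P →ₐ[k] F) (hj : Function.Injective j) (ev : P →ₐ[k] k) (h : Scaling j ev)
    (e : F ⊗[k] C) (he : e * e = e) (hρe : ρ.lTensor F e = 1 - e) :
    ∃ c : C, c * c = c ∧ ρ c = 1 - c := by
  have hart : IsArtinianRing C := IsArtinianRing.of_finite k C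
  have hss : IsSemisimpleRing C := IsSimpleRing.isSemisimpleRing_iff_isArtinianRing.mpr hart
  have hchF : CharZero F := charZero_of_injective_algebraMap (algebraMap k F).injective
  let I : Ideal C :=
    { carrier := {c | ∃ z : P ⊗[k] C, J C j z * e = J C j z ∧ Rd C ev z = c}
      zero_mem' := ⟨0, by simp, by simp⟩
      add_mem' := by
        rintro a b ⟨z, hz, rfl⟩ ⟨w, hw, rfl⟩
        exact ⟨z + w, by rw [map_add, add_mul, hz, hw], map_add _ _ _⟩
      smul_mem' := by
        rintro a b ⟨z, hz, rfl⟩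
        refine ⟨(1 ⊗ₜ a) * z, by rw [map_mul, mul_assoc, hz], ?_⟩
        rw [map_mul]
        simp }
  have hI : ∀ c, c ∈ I ↔ ∃ z : P ⊗[k] C, J C j z * e = J C j z ∧ Rd C ev z = c :=
    fun c => Iff.rfl
  have hiso : ∀ c ∈ I, c * ρ c = 0 := by
    intro c hc
    obtain ⟨z, hz, rfl⟩ := (hI c).1 hc
    have : z * ρ.lTensor P z = 0 := by
      apply J_inj j hj
      rw [map_mul, J_lT, map_zero, ← hz, lTensor_anti ρ hρmul, hρe, ← mul_assoc,
        mul_assoc (J C j z) e, mul_sub, mul_one, he, sub_self, mul_zero, zero_mul]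
    rw [← Rd_lT, ← map_mul, this, map_zero]
  obtain ⟨f, hf, hIf⟩ := IsSemisimpleRing.ideal_eq_span_idempotent I
  have hff : f * f = f := hf
  have hfI : f ∈ I := by rw [hIf]; exact Ideal.mem_span_singleton_self f
  have hmem : ∀ c ∈ I, c * f = c := by
    intro c hc
    rw [hIf, Ideal.mem_span_singleton'] at hc
    obtain ⟨a, rfl⟩ := hc
    rw [mul_assoc, hff]
  have hfg : f * ρ f = 0 := hiso f hfI
  -- trace upstairs
  have hone : TR F (F ⊗[k] C) 1 = Module.finrank k C := by
    rw [TR_apply, LinearMap.mulRight_one, LinearMap.trace_id, Module.finrank_baseChange]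
  have hone' : TR k C 1 = Module.finrank k C := by
    rw [TR_apply, LinearMap.mulRight_one, LinearMap.trace_id]
  have ht : TR F (F ⊗[k] C) e + TR F (F ⊗[k] C) e = Module.finrank k C := by
    nth_rw 1 [← TR_inv_baseChange k F C ρ hρmul hρinv e]
    rw [hρe, map_sub, hone, sub_add_cancel]
  set f' : F ⊗[k] C := 1 ⊗ₜ f with hf'
  have hff' : f' * f' = f' := by simp [hf', hff]
  have hle : Module.finrank F (LinearMap.range (LinearMap.mulRight F e)) ≤
      Module.finrank F (LinearMap.range (LinearMap.mulRight F f')) := by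
    let φ : LinearMap.range (LinearMap.mulRight F e) →ₗ[F]
        LinearMap.range (LinearMap.mulRight F f') :=
      (LinearMap.mulRight F f').rangeRestrict.comp (Submodule.subtype _)
    refine LinearMap.finrank_le_finrank_of_injective (f := φ) ?_
    rw [injective_iff_map_eq_zero]
    rintro ⟨y, hy⟩ hφ
    have hyf : y * f' = 0 := congrArg Subtype.val hφ
    have hye : y * e = y := by
      obtain ⟨x, rfl⟩ := hy
      simp [mul_assoc, he]
    by_contra hne
    obtain ⟨u, hu, z, hz, hz0⟩ := scale h y (fun h0 => hne (Subtype.ext h0))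
    have h1 : Rd C ev z ∈ I := (hI _).2 ⟨z, by rw [hz, smul_mul_assoc, hye], rfl⟩
    have h2 : z * (1 ⊗ₜ f) = 0 := by
      apply J_inj j hj
      rw [map_mul, hz, J_tmul, map_one, ← hf', smul_mul_assoc, hyf, smul_zero, map_zero]
    apply hz0
    rw [← hmem _ h1]
    have h3 := congrArg (Rd C ev) h2
    simpa using h3
  have hfr : TR F (F ⊗[k] C) f' = algebraMap k F (TR k C f) := by
    rw [hf', TR_tmul, one_mul]
  rw [TR_idem hff', TR_idem hff, map_natCast, Nat.cast_inj] at hfr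
  rw [TR_idem he] at ht
  norm_cast at ht
  -- the idempotent `p`
  set g := ρ f with hg
  have hgg : g * g = g := by rw [hg, ← hρmul, hff]
  set p := f + g - g * f with hp
  have hfgx : ∀ x, f * (g * x) = 0 := fun x => by rw [← mul_assoc, hfg, zero_mul]
  have hffx : ∀ x, f * (f * x) = f * x := fun x => by rw [← mul_assoc, hff]
  have hggx : ∀ x, g * (g * x) = g * x := fun x => by rw [← mul_assoc, hgg]
  have hpp : p * p = p := by
    simp only [hp, mul_add, add_mul, mul_sub, sub_mul, mul_assoc, hff, hfg, hgg, hfgx, hggx,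
      mul_zero]
    abel
  have htp : TR k C p = TR k C f + TR k C f := by
    rw [hp, map_sub, map_add, TR_comm g f, hfg, map_zero, sub_zero, hg, TR_inv ρ hρmul hρinv]
  rw [TR_idem hpp, TR_idem hff] at htp
  norm_cast at htp
  have hrange : LinearMap.range (LinearMap.mulRight k p) = ⊤ := by
    apply Submodule.eq_top_of_finrank_eq
    have := Submodule.finrank_le (LinearMap.range (LinearMap.mulRight k p))
    omega
  have hp1 : p = 1 := by
    have : (1 : C) ∈ LinearMap.range (LinearMap.mulRight k p) := by rw [hrange]; trivial
    obtain ⟨x, hx⟩ := this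
    have hx : x * p = 1 := hx
    calc p = (x * p) * p := by rw [hx, one_mul]
      _ = 1 := by rw [mul_assoc, hpp, hx]
  have hρg : ρ g = f := hρinv f
  refine ⟨f - (2⁻¹ : k) • (g * f), ?_, ?_⟩
  · have h1 : f * ((2⁻¹ : k) • (g * f)) = 0 := by
      rw [mul_smul_comm, hfgx]; exact smul_zero _
    have h2 : ((2⁻¹ : k) • (g * f)) * f = (2⁻¹ : k) • (g * f) := by
      rw [smul_mul_assoc, mul_assoc, hff]
    have h3 : ((2⁻¹ : k) • (g * f)) * ((2⁻¹ : k) • (g * f)) = 0 := by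
      nth_rw 1 [smul_mul_assoc]
      rw [mul_assoc, h1, mul_zero]; exact smul_zero _
    rw [mul_sub, sub_mul, sub_mul, h1, h2, h3, hff]
    abel
  · rw [map_sub, map_smul, hρmul, hρg, ← hg, ← hp1, hp]
    have : g * f = (2⁻¹ : k) • (g * f) + (2⁻¹ : k) • (g * f) := by
      rw [← add_smul, ← two_mul, mul_inv_cancel₀ two_ne_zero, one_smul]
    nth_rw 2 [this]
    abel

theorem iso_iff [FiniteDimensional k C] (ρ : C →ₗ[k] C)
    (j : P →ₐ[k] F) (hj : Function.Injective j) (ev : P →ₐ[k] k) (h : Scaling j ev) :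
    (∃ c : C, c ≠ 0 ∧ ρ c * c = 0) ↔
      ∃ y : C ⊗[k] F, y ≠ 0 ∧ TensorProduct.map ρ LinearMap.id y * y = 0 := by
  constructor
  · rintro ⟨c, hc, hc2⟩
    refine ⟨c ⊗ₜ 1, ?_, by simp [hc2]⟩
    intro h0
    apply hc
    apply Algebra.TensorProduct.includeLeft_injective (R := k) (S := k) (A := C) (B := F)
      (algebraMap k F).injective
    simpa using h0
  · rintro ⟨y, hy, hy2⟩
    let E := Algebra.TensorProduct.comm k C F
    have hE : ∀ y, ρ.lTensor F (E y) = E (TensorProduct.map ρ LinearMap.id y) := by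
      intro y
      induction y with
      | zero => simp
      | add x y hx hy => simp only [map_add, hx, hy]
      | tmul a c => simp [E]
    refine iso_descend ρ j hj ev h (E y) (by simpa using hy) ?_
    rw [hE, ← map_mul, hy2, map_zero]

theorem hyp_iff [CharZero k] [FiniteDimensional k C] [IsSimpleRing C] (ρ : C →ₗ[k] C)
    (hρmul : ∀ x y : C, ρ (x * y) = ρ y * ρ x)
    (hρinv : ∀ x : C, ρ (ρ x) = x)
    (j : P →ₐ[k] F) (hj : Function.Injective j) (ev : P →ₐ[k] k) (h : Scaling j ev) :
    (∃ c : C, c * c = c ∧ ρ c = 1 - c) ↔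
      ∃ y : C ⊗[k] F, y * y = y ∧ TensorProduct.map ρ LinearMap.id y = 1 - y := by
  constructor
  · rintro ⟨c, hc, hc2⟩
    refine ⟨c ⊗ₜ 1, by simp [hc], ?_⟩
    simp [hc2, TensorProduct.sub_tmul, Algebra.TensorProduct.one_def]
  · rintro ⟨y, hy, hy2⟩
    let E := Algebra.TensorProduct.comm k C F
    have hE : ∀ y, ρ.lTensor F (E y) = E (TensorProduct.map ρ LinearMap.id y) := by
      intro y
      induction y with
      | zero => simp
      | add x y hx hy => simp only [map_add, hx, hy]
      | tmul a c => simp [E]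
    refine hyp_descend ρ hρmul hρinv j hj ev h (E y) (by rw [← map_mul, hy]) ?_
    rw [hE, hy2, map_sub, map_one]

end

section
variable (k : Type*) [Field k]

/-- power series inside Laurent series -/
noncomputable def psIncl : PowerSeries k →ₐ[k] LaurentSeries k :=
  { HahnSeries.ofPowerSeries ℤ k with
    commutes' := fun _ => rfl }

/-- constant coefficient -/
noncomputable def psEv : PowerSeries k →ₐ[k] k :=
  { PowerSeries.constantCoeff (R := k) with
    commutes' := fun r => by simp }

lemma laurent_scaling : Scaling (k := k) (P := PowerSeries k) (F := LaurentSeries k)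
    (psIncl k) (psEv k) := by
  classical
  intro n f hf
  obtain ⟨i0, hi0⟩ := Function.ne_iff.1 hf
  obtain ⟨i, hi, hmin⟩ := Finset.exists_min_image (Finset.univ.filter fun i => f i ≠ 0)
    (fun i => (f i).order) ⟨i0, by simpa using hi0⟩
  have hi' : f i ≠ 0 := by simpa using hi
  refine ⟨HahnSeries.single (-(f i).order) 1, by simp, fun l => PowerSeries.X ^
    ((f l).order - (f i).order).toNat * LaurentSeries.powerSeriesPart (f l), ?_, i, ?_⟩
  · intro l
    change HahnSeries.ofPowerSeries ℤ k _ = _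
    by_cases hl : f l = 0
    · simp [hl]
    · have h1 := hmin l (by simpa using hl)
      rw [map_mul, LaurentSeries.ofPowerSeries_powerSeriesPart, map_pow,
        HahnSeries.ofPowerSeries_X, HahnSeries.single_pow, ← mul_assoc,
        HahnSeries.single_mul_single]
      have h2 : (f i).order ≤ (f l).order := h1
      have h3 := Int.toNat_of_nonneg (sub_nonneg.2 h2)
      have h4 : ((f l).order - (f i).order).toNat • (1 : ℤ) + -(f l).order = -(f i).order := by
        rw [nsmul_eq_mul, mul_one]
        refine (congrArg (· + -(f l).order) h3).trans ?_
        ring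
      rw [h4, one_pow, one_mul]
  · change PowerSeries.constantCoeff _ ≠ 0
    beta_reduce
    rw [sub_self, Int.toNat_zero, pow_zero, one_mul, ← PowerSeries.coeff_zero_eq_constantCoeff_apply,
      LaurentSeries.powerSeriesPart_coeff]
    simpa using hi'

end
end IsoHyp

/-- Let `k` be a field of characteristic 0, `ℓ/k` a quadratic field
extension, `C` a central simple `ℓ`-algebra and `ρ` a unitary involution on `C` fixing
`k` (its restriction to `ℓ` is the nontrivial `k`-automorphism `ι` of `ℓ`).  Let
`F̂ = k((x))` and `(C, ρ)_{F̂} = (C ⊗_k F̂, ρ ⊗ id)`.  Then `(C, ρ)` is isotropic iff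
`(C, ρ)_{F̂}` is isotropic, and `(C, ρ)` is hyperbolic iff `(C, ρ)_{F̂}` is hyperbolic. -/
theorem isotropic_hyperbolic_iff_laurent_base_change_unitary
    (k ℓ C : Type*) [Field k] [CharZero k] [Field ℓ] [Algebra k ℓ]
    (hquad : Module.finrank k ℓ = 2)
    [Ring C] [Algebra ℓ C] [Algebra k C] [IsScalarTower k ℓ C]
    [Algebra.IsCentral ℓ C] [IsSimpleRing C] [FiniteDimensional ℓ C]
    (ι : ℓ ≃ₐ[k] ℓ) (hι : ι ≠ AlgEquiv.refl)
    (ρ : C →ₗ[k] C) (hρmul : ∀ x y : C, ρ (x * y) = ρ y * ρ x)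
    (hρinv : ∀ x : C, ρ (ρ x) = x)
    (hρℓ : ∀ c : ℓ, ρ (algebraMap ℓ C c) = algebraMap ℓ C (ι c)) :
    ((∃ c : C, c ≠ 0 ∧ ρ c * c = 0) ↔
      (∃ y : C ⊗[k] LaurentSeries k, y ≠ 0 ∧
        TensorProduct.map ρ LinearMap.id y * y = 0)) ∧
    ((∃ e : C, e * e = e ∧ ρ e = 1 - e) ↔
      (∃ e : C ⊗[k] LaurentSeries k, e * e = e ∧
        TensorProduct.map ρ LinearMap.id e = 1 - e)) := by
  have : FiniteDimensional k ℓ := Module.finite_of_finrank_pos (by omega)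
  have : FiniteDimensional k C := Module.Finite.trans ℓ C
  have hj : Function.Injective (IsoHyp.psIncl k) :=
    HahnSeries.ofPowerSeries_injective
  exact ⟨IsoHyp.iso_iff ρ _ hj _ (IsoHyp.laurent_scaling k),
    IsoHyp.hyp_iff ρ hρmul hρinv _ hj _ (IsoHyp.laurent_scaling k)⟩
end

section
/- Let ℓ be a field of characteristic 0, let A be a central simple ℓ-algebra of degree m with m ≡ 2 (mod 4), and let σ be a symplectic involution on A (an involution of the first kind with dim_ℓ {x ∈ A : σ(x) = x} = m(m−1)/2). If g ∈ A satisfies σ(g) = g and g² = λ·1 for some λ ∈ ℓ^×, then λ is a square in ℓ. -/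
open scoped TensorProduct Matrix

theorem aux_even_finrank {F V : Type*} [Field F] [CharZero F] [AddCommGroup V] [Module F V]
    [FiniteDimensional F V] (B : LinearMap.BilinForm F V) (hB : ∀ x y, B x y = - B y x)
    (hnd : ∀ x, (∀ y, B x y = 0) → x = 0) : Even (Module.finrank F V) := by
  classical
  let b := Module.finBasis F V
  have hN : B.Nondegenerate := by
    refine ⟨hnd, fun x h => hnd x fun y => ?_⟩
    rw [hB, h, neg_zero]
  have hdet := (LinearMap.BilinForm.nondegenerate_iff_det_ne_zero (B := B) b).1 hN
  by_contra hodd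
  rw [Nat.not_even_iff_odd] at hodd
  apply hdet
  have ht : (LinearMap.BilinForm.toMatrix b B)ᵀ = -(LinearMap.BilinForm.toMatrix b B) := by
    ext i j
    simp [LinearMap.BilinForm.toMatrix_apply, hB (b j) (b i)]
  have := congrArg Matrix.det ht
  rw [Matrix.det_transpose, Matrix.det_neg, Fintype.card_fin, hodd.neg_one_pow] at this
  exact self_eq_neg.1 (by simpa using this)

theorem aux_trace_end_matrix {F : Type*} [Field F] {n : ℕ}
    (f : Matrix (Fin n) (Fin n) F →ₗ[F] Matrix (Fin n) (Fin n) F) :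
    LinearMap.trace F _ f = ∑ i, ∑ j, f (Matrix.single i j 1) i j := by
  classical
  rw [LinearMap.trace_eq_matrix_trace F (Matrix.stdBasis F (Fin n) (Fin n)), Matrix.trace,
    Fintype.sum_prod_type]
  refine Finset.sum_congr rfl fun i _ => Finset.sum_congr rfl fun j _ => ?_
  simp only [Matrix.diag_apply, LinearMap.toMatrix_apply, Matrix.stdBasis_eq_single]
  simp [Matrix.stdBasis]

theorem aux_trace_mulLeft {F : Type*} [Field F] {n : ℕ} (G : Matrix (Fin n) (Fin n) F) :
    LinearMap.trace F _ (LinearMap.mulLeft F G) = n * G.trace := by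
  rw [aux_trace_end_matrix]
  simp [Matrix.trace, Finset.mul_sum]

theorem aux_skolem {F : Type*} [Field F] {n : ℕ}
    (f : Matrix (Fin n) (Fin n) F ≃ₐ[F] Matrix (Fin n) (Fin n) F) :
    ∃ P Q : Matrix (Fin n) (Fin n) F, P * Q = 1 ∧ Q * P = 1 ∧ ∀ x, f x = P * x * Q := by
  let t : Matrix (Fin n) (Fin n) F ≃ₐ[F] _ := Matrix.toLinAlgEquiv'
  obtain ⟨T, hT⟩ := AlgEquiv.eq_linearEquivConjAlgEquiv ((t.symm.trans f).trans t)
  refine ⟨t.symm T.toLinearMap, t.symm T.symm.toLinearMap, ?_, ?_, fun x => ?_⟩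
  · rw [← map_mul, ← map_one t.symm]; congr 1; ext; simp
  · rw [← map_mul, ← map_one t.symm]; congr 1; ext; simp
  · have := congrArg (fun h => t.symm (h (t x))) hT
    simp only [AlgEquiv.trans_apply, AlgEquiv.symm_apply_apply, LinearEquiv.conjAlgEquiv_apply] at this
    rw [this]
    apply t.injective
    simp only [map_mul, AlgEquiv.apply_symm_apply]
    rfl

theorem aux_core {F : Type*} [Field F] [CharZero F] {n : ℕ} (hn : n ≠ 0)
    (s : Matrix (Fin n) (Fin n) F →ₗ[F] Matrix (Fin n) (Fin n) F)
    (hmul : ∀ x y, s (x * y) = s y * s x) (hinv : ∀ x, s (s x) = x)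
    (htr : LinearMap.trace F _ s = -(n : F)) (G : Matrix (Fin n) (Fin n) F) (hG : s G = G)
    (mu : F) (hmu : mu ≠ 0) (hG2 : G * G = (mu * mu) • 1) :
    ∃ r : ℕ, Even r ∧ G.trace = mu * (2 * r - n) := by
  classical
  have hs1 : s 1 = 1 := by
    have h := hmul 1 (s 1)
    rw [one_mul, hinv, one_mul] at h
    exact h.symm
  let f : Matrix (Fin n) (Fin n) F ≃ₐ[F] Matrix (Fin n) (Fin n) F :=
    AlgEquiv.ofBijective
      (AlgHom.ofLinearMap
        (s ∘ₗ (Matrix.transposeLinearEquiv (Fin n) (Fin n) F F).toLinearMap)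
        (by simp [hs1]) (by intro x y; simp [hmul]))
      ⟨by
        intro x y hxy
        have h : s xᵀ = s yᵀ := hxy
        have h2 := congrArg s h
        rw [hinv, hinv] at h2
        exact Matrix.transpose_injective h2, by
        intro y
        refine ⟨(s y)ᵀ, ?_⟩
        change s ((s y)ᵀᵀ) = y
        rw [Matrix.transpose_transpose, hinv]⟩
  obtain ⟨P, Q, hPQ, hQP, hf⟩ := aux_skolem f
  have hs : ∀ x, s x = P * xᵀ * Q := by
    intro x
    rw [← hf]
    change s x = s xᵀᵀ
    rw [Matrix.transpose_transpose]
  have hPQt : Qᵀ * Pᵀ = 1 := by rw [← Matrix.transpose_mul, hPQ, Matrix.transpose_one]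
  have hQPt : Pᵀ * Qᵀ = 1 := by rw [← Matrix.transpose_mul, hQP, Matrix.transpose_one]
  have hcomm : ∀ x, (P * Qᵀ) * x = x * (P * Qᵀ) := by
    intro x
    have h := hinv x
    rw [hs, hs] at h
    simp only [Matrix.transpose_mul, Matrix.transpose_transpose] at h
    calc (P * Qᵀ) * x = (P * (Qᵀ * (x * Pᵀ)) * Q) * (P * Qᵀ) := by
          simp only [Matrix.mul_assoc]
          rw [← Matrix.mul_assoc Q P, hQP, Matrix.one_mul, hQPt, Matrix.mul_one]
      _ = _ := by rw [h]
  obtain ⟨c, hc⟩ := Matrix.mem_range_scalar_of_commute_single (M := P * Qᵀ)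
    (fun i j _ => (hcomm _).symm)
  have htr2 : LinearMap.trace F _ s = (P * Qᵀ).trace := by
    rw [aux_trace_end_matrix]
    simp only [hs, Matrix.trace, Matrix.diag_apply, Matrix.transpose_single]
    refine Finset.sum_congr rfl fun i _ => ?_
    rw [Matrix.mul_apply]
    refine Finset.sum_congr rfl fun j _ => ?_
    rw [Matrix.mul_apply, Finset.sum_eq_single i]
    · simp [Matrix.mul_single_apply_same]
    · intro b _ hb
      rw [Matrix.mul_single_apply_of_ne _ _ _ _ _ hb, zero_mul]
    · simp
  have hc1 : c = -1 := by
    rw [htr, ← hc] at htr2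
    have hn' : (n : F) ≠ 0 := by exact_mod_cast hn
    simp [Matrix.trace] at htr2
    apply mul_left_cancel₀ hn'
    rw [← htr2]; ring
  have hskew : Pᵀ = -P := by
    have : P * Qᵀ = -1 := by rw [← hc, hc1, map_neg, map_one]
    calc Pᵀ = -((-1) * Pᵀ) := by simp
      _ = -(P * (Qᵀ * Pᵀ)) := by rw [← this, Matrix.mul_assoc]
      _ = -P := by rw [hPQt, Matrix.mul_one]
  have hPG : P * Gᵀ = G * P := by
    have h := hs G
    rw [hG] at h
    conv_rhs => rw [h]
    rw [Matrix.mul_assoc _ Q, hQP, Matrix.mul_one]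
  let E : Matrix (Fin n) (Fin n) F := (2⁻¹ : F) • (1 + mu⁻¹ • G)
  have hEE : E * E = E := by
    simp only [E, Matrix.smul_mul, Matrix.mul_smul, Matrix.add_mul, Matrix.mul_add, hG2,
      Matrix.one_mul, Matrix.mul_one, smul_smul, smul_add]
    have : 2⁻¹ * (2⁻¹ * (mu⁻¹ * (mu⁻¹ * (mu * mu)))) = (2⁻¹ * 2⁻¹ : F) := by field_simp
    ext i j
    simp only [Matrix.add_apply, Matrix.smul_apply, smul_eq_mul]
    field_simp
    ring
  have hPE : P * Eᵀ = E * P := by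
    simp [E, Matrix.mul_add, Matrix.add_mul, hPG]
  let p : (Fin n → F) →ₗ[F] (Fin n → F) := Matrix.toLin' Eᵀ
  have hpp : IsIdempotentElem p := by
    have : Eᵀ * Eᵀ = Eᵀ := by rw [← Matrix.transpose_mul, hEE]
    change Matrix.toLin' Eᵀ ∘ₗ Matrix.toLin' Eᵀ = Matrix.toLin' Eᵀ
    rw [← Matrix.toLin'_mul, this]
  have hproj := (LinearMap.isProj_range_iff_isIdempotentElem p).2 hpp
  have htrp := hproj.trace
  refine ⟨Module.finrank F (LinearMap.range p), ?_, ?_⟩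
  · let B0 : LinearMap.BilinForm F (Fin n → F) := Matrix.toBilin' P
    have hB0 : ∀ x y, B0 x y = x ⬝ᵥ (P *ᵥ y) := fun x y => Matrix.toBilin'_apply' P x y
    have hB0s : ∀ x y, B0 x y = - B0 y x := by
      intro x y
      rw [hB0, hB0, Matrix.dotProduct_mulVec, ← Matrix.mulVec_transpose, hskew,
        Matrix.neg_mulVec, neg_dotProduct, dotProduct_comm]
    refine aux_even_finrank (B0.restrict (LinearMap.range p)) ?_ ?_
    · intro x y; exact hB0s x y
    · rintro ⟨x, hx⟩ h
      have hx' : Eᵀ *ᵥ x = x := hproj.map_id x hx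
      have h0 : ∀ w, x ⬝ᵥ (P *ᵥ w) = 0 := by
        intro w
        have h1 : x ⬝ᵥ (P *ᵥ (Eᵀ *ᵥ w)) = 0 := by
          rw [← hB0]
          exact h ⟨p w, LinearMap.mem_range_self p w⟩
        rw [Matrix.mulVec_mulVec, hPE, ← Matrix.mulVec_mulVec, Matrix.dotProduct_mulVec,
          ← Matrix.mulVec_transpose, hx'] at h1
        exact h1
      have : x = 0 := by
        apply dotProduct_eq_zero
        intro w
        have := h0 (Q *ᵥ w)
        rwa [Matrix.mulVec_mulVec, hPQ, Matrix.one_mulVec] at this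
      exact Subtype.ext this
  · rw [← htrp]
    change _ = mu * (2 * LinearMap.trace F _ (Matrix.toLin' Eᵀ) - n)
    rw [Matrix.trace_toLin'_eq, Matrix.trace_transpose]
    simp only [E, Matrix.trace_smul, Matrix.trace_add, Matrix.trace_one, Fintype.card_fin, smul_eq_mul]
    field_simp
    ring

theorem aux_simple (K L A : Type*) [Field K] [Field L] [Algebra K L] [Ring A] [Algebra K A]
    [Algebra.IsCentral K A] [IsSimpleRing A] : IsSimpleRing (L ⊗[K] A) := by
  classical
  let b := Module.Basis.ofVectorSpace K L
  let c := TensorProduct.equivFinsuppOfBasisLeft (N := A) b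
  have hl : ∀ (a : A) (x : L ⊗[K] A) i, c ((1 ⊗ₜ a) * x) i = a * c x i := by
    intro a x i
    induction x using TensorProduct.induction_on with
    | zero => simp
    | tmul l y => simp [c, TensorProduct.equivFinsuppOfBasisLeft_apply_tmul_apply]
    | add x y hx hy => simp [mul_add, hx, hy]
  have hr : ∀ (a : A) (x : L ⊗[K] A) i, c (x * (1 ⊗ₜ a)) i = c x i * a := by
    intro a x i
    induction x using TensorProduct.induction_on with
    | zero => simp
    | tmul l y => simp [c, TensorProduct.equivFinsuppOfBasisLeft_apply_tmul_apply]
    | add x y hx hy => simp [add_mul, hx, hy]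
  rw [isSimpleRing_iff_isTwoSided_imp]
  refine ⟨inferInstance, fun I hI => ?_⟩
  rw [or_iff_not_imp_left]
  intro hne
  obtain ⟨x0, hx0, hx0'⟩ := Submodule.exists_mem_ne_zero_of_ne_bot hne
  -- an element of minimal support
  have hex : ∃ n : ℕ, ∃ x ∈ I, x ≠ 0 ∧ (c x).support.card = n := ⟨_, x0, hx0, hx0', rfl⟩
  obtain ⟨x, hxI, hx, hcard⟩ := Nat.find_spec hex
  have hmin : ∀ y ∈ I, (c y).support.card < (c x).support.card → y = 0 := by
    intro y hy hlt
    by_contra hy0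
    rw [hcard] at hlt
    exact Nat.find_min hex hlt ⟨y, hy, hy0, rfl⟩
  have hcx : c x ≠ 0 := by simpa using hx
  obtain ⟨i, hi⟩ := Finsupp.ne_iff.1 hcx
  let J : Ideal A :=
    { carrier := {a | ∃ y ∈ I, (c y).support ⊆ (c x).support ∧ c y i = a}
      zero_mem' := ⟨0, I.zero_mem, by simp, by simp⟩
      add_mem' := by
        rintro _ _ ⟨y, hy, hys, rfl⟩ ⟨z, hz, hzs, rfl⟩
        refine ⟨y + z, I.add_mem hy hz, ?_, by simp⟩
        rw [map_add]
        exact Finsupp.support_add.trans (Finset.union_subset hys hzs)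
      smul_mem' := by
        rintro a _ ⟨y, hy, hys, rfl⟩
        refine ⟨(1 ⊗ₜ a) * y, I.mul_mem_left _ hy, ?_, by simp [hl]⟩
        intro j hj
        apply hys
        rw [Finsupp.mem_support_iff] at hj ⊢
        intro h0
        exact hj (by rw [hl, h0, mul_zero]) }
  have hJ : J.IsTwoSided := by
    constructor
    rintro _ a ⟨y, hy, hys, rfl⟩
    refine ⟨y * (1 ⊗ₜ a), I.mul_mem_right _ hy, ?_, by simp [hr]⟩
    intro j hj
    apply hys
    rw [Finsupp.mem_support_iff] at hj ⊢
    intro h0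
    exact hj (by rw [hr, h0, zero_mul])
  have hJtop : J = ⊤ := by
    rcases (isSimpleRing_iff_isTwoSided_imp.1 ‹IsSimpleRing A›).2 J hJ with h | h
    · exfalso
      have : c x i ∈ J := ⟨x, hxI, subset_rfl, rfl⟩
      rw [h, Ideal.mem_bot] at this
      exact hi (by simpa using this)
    · exact h
  obtain ⟨y, hyI, hys, hy1⟩ : (1 : A) ∈ J := by rw [hJtop]; trivial
  have hcent : ∀ (a : A), (1 ⊗ₜ a) * y = y * (1 ⊗ₜ a) := by
    intro a
    rw [← sub_eq_zero]
    apply hmin _ (I.sub_mem (I.mul_mem_left _ hyI) (I.mul_mem_right _ hyI))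
    apply Finset.card_lt_card
    rw [Finset.ssubset_iff_of_subset]
    · refine ⟨i, by simpa using hi, ?_⟩
      rw [Finsupp.notMem_support_iff, map_sub, Finsupp.sub_apply, hl, hr, hy1]
      simp
    · intro j hj
      apply hys
      rw [Finsupp.mem_support_iff] at hj ⊢
      intro h0
      exact hj (by rw [map_sub, Finsupp.sub_apply, hl, hr, h0]; simp)
  have hk : ∀ j, ∃ k : K, algebraMap K A k = c y j := by
    intro j
    have : c y j ∈ Subalgebra.center K A := by
      rw [Subalgebra.mem_center_iff]
      intro a
      rw [← hl, ← hr, hcent]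
    rw [Algebra.IsCentral.center_eq_bot, Algebra.mem_bot] at this
    exact this
  choose k hk using hk
  have hy : ∃ l : L, y = l ⊗ₜ 1 := by
    refine ⟨∑ j ∈ (c y).support, k j • b j, ?_⟩
    have hyc : y = ∑ j ∈ (c y).support, b j ⊗ₜ[K] (c y) j := by
      conv_lhs => rw [← c.symm_apply_apply y]
      rw [TensorProduct.equivFinsuppOfBasisLeft_symm_apply, Finsupp.sum]
    conv_lhs => rw [hyc]
    rw [TensorProduct.sum_tmul]
    refine Finset.sum_congr rfl fun j _ => ?_
    rw [← hk j, Algebra.algebraMap_eq_smul_one, TensorProduct.tmul_smul, TensorProduct.smul_tmul']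
  obtain ⟨l, rfl⟩ := hy
  have hl0 : l ≠ 0 := by
    rintro rfl
    simp at hy1
  rw [Ideal.eq_top_iff_one]
  have := I.mul_mem_left (l⁻¹ ⊗ₜ 1) hyI
  rwa [Algebra.TensorProduct.tmul_mul_tmul, inv_mul_cancel₀ hl0, mul_one,
    ← Algebra.TensorProduct.one_def] at this

theorem aux_trace_sigma (K A : Type*) [Field K] [CharZero K] [AddCommGroup A] [Module K A]
    [FiniteDimensional K A] (m : ℕ) (hdeg : Module.finrank K A = m ^ 2) (hm : m % 4 = 2)
    (σ : A →ₗ[K] A) (hσinv : ∀ x : A, σ (σ x) = x)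
    (hsymp : Module.finrank K (LinearMap.ker (σ - LinearMap.id)) = m * (m - 1) / 2) :
    LinearMap.trace K A σ = -(m : K) := by
  have hproj : LinearMap.IsProj (LinearMap.ker (σ - LinearMap.id))
      ((2⁻¹ : K) • (LinearMap.id + σ)) := by
    constructor
    · intro x
      simp [LinearMap.mem_ker, hσinv, sub_eq_zero, add_comm]
    · intro x hx
      have hx' : σ x = x := by simpa [LinearMap.mem_ker, sub_eq_zero] using hx
      simp only [LinearMap.smul_apply, LinearMap.add_apply, LinearMap.id_apply, hx']
      rw [← two_smul K x, smul_smul, inv_mul_cancel₀ two_ne_zero, one_smul]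
  have h := hproj.trace
  rw [hsymp, map_smul, map_add, LinearMap.trace_id, hdeg] at h
  obtain ⟨k, rfl⟩ : ∃ k, m = 2 * k + 2 := ⟨(m - 2) / 2, by omega⟩
  have : (2 * k + 2) * (2 * k + 2 - 1) / 2 = (k + 1) * (2 * k + 1) := by
    rw [show (2 * k + 2) * (2 * k + 2 - 1) = 2 * ((k + 1) * (2 * k + 1)) by
      rw [show 2 * k + 2 - 1 = 2 * k + 1 by omega]; ring]
    simp
  rw [this] at h
  push_cast at h ⊢
  rw [smul_eq_mul, inv_mul_eq_iff_eq_mul₀ two_ne_zero] at h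
  linear_combination h

/-- Let `ℓ` be a field of characteristic 0, `A` a central simple
`ℓ`-algebra of degree `m ≡ 2 (mod 4)`, and `σ` a symplectic involution on `A` (an
involution of the first kind whose space of symmetric elements has dimension
`m(m−1)/2`).  If `g ∈ A` satisfies `σ g = g` and `g² = λ·1` with `λ ∈ ℓ^×`, then `λ`
is a square in `ℓ`. -/
theorem square_of_symmetric_square_root_symplectic
    (ℓ A : Type*) [Field ℓ] [CharZero ℓ] [Ring A] [Algebra ℓ A]
    [Algebra.IsCentral ℓ A] [IsSimpleRing A] [FiniteDimensional ℓ A]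
    (m : ℕ) (hdeg : Module.finrank ℓ A = m ^ 2) (hm : m % 4 = 2)
    (σ : A →ₗ[ℓ] A) (hσmul : ∀ x y : A, σ (x * y) = σ y * σ x)
    (hσinv : ∀ x : A, σ (σ x) = x)
    (hsymp : Module.finrank ℓ (LinearMap.ker (σ - LinearMap.id)) = m * (m - 1) / 2)
    (g : A) (hg : σ g = g) (lam : ℓ) (hlam : lam ≠ 0)
    (hg2 : g * g = algebraMap ℓ A lam) :
    ∃ b : ℓ, b * b = lam := by
  have htrσ := aux_trace_sigma ℓ A m hdeg hm σ hσinv hsymp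
  let L := AlgebraicClosure ℓ
  have hCZ : CharZero L := charZero_of_injective_algebraMap (algebraMap ℓ L).injective
  have hsimple : IsSimpleRing (L ⊗[ℓ] A) := aux_simple ℓ L A
  obtain ⟨n, hn0, ⟨e⟩⟩ := IsSimpleRing.exists_algEquiv_matrix_of_isAlgClosed L (L ⊗[ℓ] A)
  have hnm : n = m := by
    have h := e.toLinearEquiv.finrank_eq
    rw [Module.finrank_baseChange, hdeg, Module.finrank_matrix] at h
    simp only [Fintype.card_fin, Module.finrank_self, mul_one] at h
    exact (Nat.pow_left_injective (n := 2) two_ne_zero (by simpa [sq] using h)).symm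
  subst hnm
  let τ : L ⊗[ℓ] A →ₗ[L] L ⊗[ℓ] A := σ.baseChange L
  have hτmul : ∀ x y, τ (x * y) = τ y * τ x := by
    intro x y
    induction x using TensorProduct.induction_on with
    | zero => simp
    | add x x' hx hx' => simp [add_mul, mul_add, hx, hx']
    | tmul l a =>
      induction y using TensorProduct.induction_on with
      | zero => simp
      | add x x' hx hx' => simp [add_mul, mul_add, hx, hx']
      | tmul l' a' => simp [τ, hσmul, mul_comm]
  have hτinv : ∀ x, τ (τ x) = x := by
    intro x
    induction x using TensorProduct.induction_on with
    | zero => simp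
    | add x x' hx hx' => simp [hx, hx']
    | tmul l a => simp [τ, hσinv]
  let s := e.toLinearEquiv.conj τ
  have hs : ∀ x, s x = e (τ (e.symm x)) := fun x => rfl
  let G := e (1 ⊗ₜ g)
  obtain ⟨mu, hmu⟩ := IsAlgClosed.exists_pow_nat_eq (algebraMap ℓ L lam) (n := 2) two_pos
  have hmu0 : mu ≠ 0 := by
    rintro rfl
    rw [zero_pow two_ne_zero] at hmu
    exact hlam ((algebraMap ℓ L).injective (by rw [← hmu, map_zero]))
  obtain ⟨r, hr, htrG⟩ := aux_core hn0.out s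
    (by intro x y; simp [hs, hτmul]) (by intro x; simp [hs, hτinv])
    (by
      rw [LinearMap.trace_conj', LinearMap.trace_baseChange, htrσ]; simp)
    G (by simp [hs, G, τ, hg]) mu hmu0
    (by
      rw [← sq mu, hmu]
      simp only [G]
      rw [← map_mul, Algebra.TensorProduct.tmul_mul_tmul, hg2, mul_one,
        Algebra.algebraMap_eq_smul_one, TensorProduct.tmul_smul, TensorProduct.smul_tmul',
        Algebra.smul_def, mul_one, ← mul_one (algebraMap ℓ L lam), ← smul_eq_mul,
        ← TensorProduct.smul_tmul', map_smul, ← Algebra.TensorProduct.one_def, map_one]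
      simp)
  have hT : algebraMap ℓ L (LinearMap.trace ℓ A (LinearMap.mulLeft ℓ g)) = n * G.trace := by
    rw [← aux_trace_mulLeft, ← LinearMap.trace_baseChange,
      ← LinearMap.trace_conj' _ e.toLinearEquiv]
    congr 1
    ext1 x
    obtain ⟨y, rfl⟩ := e.surjective x
    have : ∀ y, (LinearMap.mulLeft ℓ g).baseChange L y = (1 ⊗ₜ g) * y := by
      intro y
      induction y using TensorProduct.induction_on with
      | zero => simp
      | add x x' hx hx' => simp only [map_add, mul_add, hx, hx']
      | tmul l a => simp
    simp [LinearEquiv.conj_apply, this, G]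
  have hne : (n : ℓ) * (2 * r - n) ≠ 0 := by
    apply mul_ne_zero
    · exact_mod_cast hn0.out
    · intro h
      have h2 : 2 * r = n := by exact_mod_cast sub_eq_zero.1 h
      obtain ⟨q, hq⟩ := hr
      omega
  refine ⟨LinearMap.trace ℓ A (LinearMap.mulLeft ℓ g) / (n * (2 * r - n)), ?_⟩
  apply (algebraMap ℓ L).injective
  have hb : algebraMap ℓ L (LinearMap.trace ℓ A (LinearMap.mulLeft ℓ g) / (n * (2 * r - n))) = mu := by
    rw [map_div₀, hT, htrG]
    have hne' := (map_ne_zero (algebraMap ℓ L)).2 hne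
    rw [div_eq_iff hne']
    simp only [map_mul, map_sub, map_natCast, map_ofNat]
    ring
  rw [map_mul, hb, ← sq, hmu]
end
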